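/- Let B_t = R/I_t(φ) be standard determinantal of codimension c = 2 with J := I_{t−1}(φ) and M = coker(φ*). If depth_J B_t ≥ 4, then Tor_1^R(M, M) ≅ S₂M ⊗_R I_t(φ) as graded R-modules. -/

import Mathlib

/-!
Common setup for formalizing "Schur powers of the cokernel of a graded morphism"
by J.O. Kleppe and R.M. Miró-Roig.
-/

open Matrix TensorProduct CategoryTheory

noncomputable section

namespace KMR

/-- The standard graded polynomial ring `R = k[x₀,…,xₙ]`. -/
abbrev RR (k : Type) [Field k] (n : ℕ) : Type := MvPolynomial (Fin (n + 1)) k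

variable {k : Type} [Field k] {n : ℕ}

/-- The irrelevant maximal ideal `𝔪 = (x₀,…,xₙ)`. -/
def mxI (k : Type) [Field k] (n : ℕ) : Ideal (RR k n) :=
  Ideal.span (Set.range MvPolynomial.X)

/-- The ideal `I_j(A)` generated by the `j × j` minors of the matrix `A`. -/
def minors {g t : ℕ} (A : Matrix (Fin g) (Fin t) (RR k n)) (j : ℕ) : Ideal (RR k n) :=
  Ideal.span {m | ∃ (r : Fin j → Fin g) (c : Fin j → Fin t),
    Function.Injective r ∧ Function.Injective c ∧ m = (A.submatrix r c).det}

/-- The matrix `A` represents a graded morphism `φ : F = ⊕ R(bⱼ) → G = ⊕ R(aᵢ)`,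
i.e. each entry `A i j` is homogeneous of degree `aᵢ - bⱼ` (or zero). -/
def IsHomogMatrix {g t : ℕ} (A : Matrix (Fin g) (Fin t) (RR k n))
    (a : Fin g → ℤ) (b : Fin t → ℤ) : Prop :=
  ∀ i j, A i j = 0 ∨ ∃ d : ℕ, (d : ℤ) = a i - b j ∧ (A i j).IsHomogeneous d

/-- The morphism `φ` is minimal, i.e. `φ(F) ⊆ 𝔪 G`:
all entries of a representing matrix have vanishing constant term. -/
def IsMinMatrix {g t : ℕ} (A : Matrix (Fin g) (Fin t) (RR k n)) : Prop :=
  ∀ i j, MvPolynomial.constantCoeff (A i j) = 0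

/-- `depthGE J N d` : there is an `N`-regular sequence of length `d` inside `J`,
i.e. `depth_J N ≥ d`. -/
def depthGE {R : Type} [CommRing R] (J : Ideal R) (N : Type) [AddCommGroup N] [Module R N]
    (d : ℕ) : Prop :=
  ∃ rs : List R, rs.length = d ∧ (∀ x ∈ rs, x ∈ J) ∧ RingTheory.Sequence.IsRegular N rs

/-- `depthEQ J N d` : the length of a maximal `N`-regular sequence in `J` is exactly `d`. -/
def depthEQ {R : Type} [CommRing R] (J : Ideal R) (N : Type) [AddCommGroup N] [Module R N]
    (d : ℕ) : Prop :=
  depthGE J N d ∧ ¬ depthGE J N (d + 1)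

/-- The morphism `φ : F → G` of free modules represented by the matrix `A`. -/
def phi {g t : ℕ} (A : Matrix (Fin g) (Fin t) (RR k n)) :
    (Fin t → RR k n) →ₗ[RR k n] (Fin g → RR k n) := A.mulVecLin

/-- The dual morphism `φ* : G* → F*`, represented by the transposed matrix. -/
def phiStar {g t : ℕ} (A : Matrix (Fin g) (Fin t) (RR k n)) :
    (Fin g → RR k n) →ₗ[RR k n] (Fin t → RR k n) := A.transpose.mulVecLin

/-- `M = coker (φ*)`. -/
abbrev Mdl {g t : ℕ} (A : Matrix (Fin g) (Fin t) (RR k n)) : Type :=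
  (Fin t → RR k n) ⧸ LinearMap.range (phiStar A)

/-- The canonical projection `F* → M = coker φ*`. -/
def MdlProj {g t : ℕ} (A : Matrix (Fin g) (Fin t) (RR k n)) :
    (Fin t → RR k n) →ₗ[RR k n] Mdl A :=
  Submodule.mkQ _

/-- The `i`-th symmetric power of a module, as a quotient of the `i`-th tensor power. -/
abbrev SymPow (R : Type) [CommRing R] (M : Type) [AddCommGroup M] [Module R M] (i : ℕ) : Type :=
  (⨂[R]^i M) ⧸ Submodule.span R
    {z | ∃ (σ : Equiv.Perm (Fin i)) (f : Fin i → M),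
      z = PiTensorProduct.tprod R f - PiTensorProduct.tprod R (f ∘ σ)}

section ExtPow

variable {R M N : Type} [CommRing R] [AddCommGroup M] [Module R M]
  [AddCommGroup N] [Module R N]

lemma extPow_map_mem (p : ℕ) (f : M →ₗ[R] N) {x : ExteriorAlgebra R M}
    (hx : x ∈ ⋀[R]^p M) : ExteriorAlgebra.map f x ∈ ⋀[R]^p N := by
  rw [← ExteriorAlgebra.ιMulti_span_fixedDegree] at hx ⊢
  induction hx using Submodule.span_induction with
  | mem x h =>
      obtain ⟨v, rfl⟩ := h
      rw [ExteriorAlgebra.map_apply_ιMulti]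
      exact Submodule.subset_span ⟨_, rfl⟩
  | zero => simpa using Submodule.zero_mem _
  | add x y _ _ h1 h2 => simpa using Submodule.add_mem _ h1 h2
  | smul r x _ h => simpa using Submodule.smul_mem _ r h

/-- The induced map `⋀^p M → ⋀^p N` of a linear map `f : M → N`. -/
def extPowMap (p : ℕ) (f : M →ₗ[R] N) : (⋀[R]^p M) →ₗ[R] (⋀[R]^p N) :=
  (ExteriorAlgebra.map f).toLinearMap.restrict (fun _ hx => extPow_map_mem p f hx)

end ExtPow

section Wedge

variable (R L : Type) [CommRing R] [AddCommGroup L] [Module R L]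

/-- Auxiliary map `L ⊗ L → Λ(L)`, `x ⊗ y ↦ ι x * ι y`. -/
def wedgeToAlg : L ⊗[R] L →ₗ[R] ExteriorAlgebra R L :=
  (LinearMap.mul' R (ExteriorAlgebra R L)).comp
    (TensorProduct.map (ExteriorAlgebra.ι R) (ExteriorAlgebra.ι R))

lemma wedgeToAlg_mem (z : L ⊗[R] L) : wedgeToAlg R L z ∈ ⋀[R]^2 L := by
  induction z using TensorProduct.induction_on with
  | zero => simpa using Submodule.zero_mem _
  | tmul x y =>
      have : wedgeToAlg R L (x ⊗ₜ[R] y) =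
          ExteriorAlgebra.ι R x * ExteriorAlgebra.ι R y := by
        simp [wedgeToAlg]
      have h2 : (⋀[R]^2 L) =
          LinearMap.range (ExteriorAlgebra.ι R (M := L)) *
            LinearMap.range (ExteriorAlgebra.ι R (M := L)) := pow_two _
      rw [this, h2]
      exact Submodule.mul_mem_mul (LinearMap.mem_range_self _ x) (LinearMap.mem_range_self _ y)
  | add x y h1 h2 => simpa using Submodule.add_mem _ h1 h2

/-- The wedge product map `L ⊗ L → ⋀² L`, `x ⊗ y ↦ x ∧ y`. -/
def wedge2 : L ⊗[R] L →ₗ[R] (⋀[R]^2 L) :=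
  (wedgeToAlg R L).codRestrict _ (wedgeToAlg_mem R L)

end Wedge

section ExtTor

variable (R : Type) [CommRing R]

/-- `Ext^i_R(M, N)` as an object of `ModuleCat R` (via the derived functor `Ext`). -/
abbrev ExtM (i : ℕ) (M N : Type) [AddCommGroup M] [Module R M] [AddCommGroup N] [Module R N] :
    ModuleCat R :=
  ((Ext R (ModuleCat R) i).obj (Opposite.op (ModuleCat.of R M))).obj (ModuleCat.of R N)

/-- `Tor_i^R(M, N)` as an object of `ModuleCat R` (via the derived functor `Tor`). -/
abbrev TorM (i : ℕ) (M N : Type) [AddCommGroup M] [Module R M] [AddCommGroup N] [Module R N] :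
    ModuleCat R :=
  ((Tor (ModuleCat R) i).obj (ModuleCat.of R M)).obj (ModuleCat.of R N)

/-- Isomorphism of `R`-modules, stated for objects of `ModuleCat R`. -/
def misoM {R : Type} [CommRing R] (X Y : ModuleCat R) : Prop := Nonempty (X ≅ Y)

end ExtTor

section Schur

/-- The cells of the Young diagram whose `r`-th row has length `lens r`. -/
abbrev YoungCells (m : ℕ) (lens : Fin m → ℕ) : Type := Σ r : Fin m, Fin (lens r)

variable (R M : Type) [CommRing R] [AddCommGroup M] [Module R M]

/-- The action of a permutation of the index set on a tensor power. -/
def permAct {ι : Type} [Fintype ι] (σ : Equiv.Perm ι) :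
    (⨂[R] _ : ι, M) →ₗ[R] (⨂[R] _ : ι, M) :=
  (PiTensorProduct.reindex R (fun _ : ι => M) σ).toLinearMap

open scoped Classical in
/-- The Young symmetrizer attached to the Young diagram with row lengths `lens`:
`e = Σ_{σ ∈ RowStab} Σ_{τ ∈ ColStab} sgn(τ) • (σ τ)` acting on the tensor power of `M`
indexed by the cells of the diagram.  (We work in characteristic zero, where its image
is the Schur power `Σ^I M` for the partition `I` with conjugate row lengths `lens`.) -/
def youngSymmetrizer (m : ℕ) (lens : Fin m → ℕ) :
    (⨂[R] _ : YoungCells m lens, M) →ₗ[R] (⨂[R] _ : YoungCells m lens, M) :=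
  ∑ σ : Equiv.Perm (YoungCells m lens), ∑ τ : Equiv.Perm (YoungCells m lens),
    if (∀ x, (σ x).1 = x.1) ∧ (∀ x, ((τ x).2 : ℕ) = ((x.2 : ℕ))) then
      ((Equiv.Perm.sign τ : ℤ) • permAct R M (σ * τ))
    else 0

/-- The Schur power `Σ^I M` of `M`, for the partition `I` whose Young diagram has
row lengths `lens` (read as a Young diagram; rows of the diagram of `I`). -/
abbrev SchurPow (m : ℕ) (lens : Fin m → ℕ) : Type :=
  ↥(LinearMap.range (youngSymmetrizer R M m lens))

end Schur

section SymZ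

variable {g t : ℕ} (A : Matrix (Fin g) (Fin t) (RR k n))

/-- Auxiliary: `SZ A 0 = Hom_R(M, R/I_t(A)) = S_{-1}M` and `SZ A (m+1) = S_m M`. -/
def SZ : ℕ → Type
  | 0 => Mdl A →ₗ[RR k n] (RR k n ⧸ minors A t)
  | (m + 1) => SymPow (RR k n) (Mdl A) m

instance : ∀ m, AddCommGroup (SZ A m)
  | 0 => inferInstanceAs (AddCommGroup (Mdl A →ₗ[RR k n] (RR k n ⧸ minors A t)))
  | (m + 1) => inferInstanceAs (AddCommGroup (SymPow (RR k n) (Mdl A) m))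

instance : ∀ m, Module (RR k n) (SZ A m)
  | 0 => inferInstanceAs (Module (RR k n) (Mdl A →ₗ[RR k n] (RR k n ⧸ minors A t)))
  | (m + 1) => inferInstanceAs (Module (RR k n) (SymPow (RR k n) (Mdl A) m))

/-- `S_i M` for `i ∈ ℤ`, `i ≥ -1`:  `SymZ A (-1) = Hom(M, B_t)` and `SymZ A i = S_i M`
for `i ≥ 0` (junk value `Hom(M, B_t)` for `i < -1`). -/
abbrev SymZ (i : ℤ) : Type := SZ A (i + 1).toNat

end SymZ

section IdealTransform

variable {R : Type} [CommRing R] (J : Ideal R)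
variable (N : Type) [AddCommGroup N] [Module R N]

/-- `Hom_R(Jᵛ, N)`. -/
abbrev homPow (ν : ℕ) : Type := ↥(J ^ ν) →ₗ[R] N

/-- Restriction `Hom(Jᵛ, N) → Hom(Jᵘ, N)` along `Jᵘ ⊆ Jᵛ` for `ν ≤ μ`. -/
def homPowMap (ν μ : ℕ) (h : ν ≤ μ) : homPow J N ν →ₗ[R] homPow J N μ :=
  LinearMap.lcomp R N (Submodule.inclusion (Ideal.pow_le_pow_right h))

/-- The ideal transform `D_J(N) = colim_ν Hom_R(Jᵛ, N)`.  By Deligne's formula this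
computes `H⁰_*(U, Ñ)` for `U` the complement of `V(J)`. -/
abbrev IdealTransform : Type := Module.DirectLimit (homPow J N) (homPowMap J N)

end IdealTransform

/-- A homogeneous ideal of `R = k[x₀,…,xₙ]`. -/
def IsHomogIdeal (I : Ideal (RR k n)) : Prop :=
  ∀ f ∈ I, ∀ d : ℕ, MvPolynomial.homogeneousComponent d f ∈ I

/-- The identity element of `V ⊗ V*` for the free module `V = R^m` (both `V` and its
dual realized as `Fin m → R`). -/
def idElem (R : Type) [CommRing R] (m : ℕ) : (Fin m → R) ⊗[R] (Fin m → R) :=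
  ∑ i : Fin m, (Pi.single i 1) ⊗ₜ[R] (Pi.single i 1)

end KMR

namespace KMR

section ExtVanish

open CategoryTheory.Abelian

variable {R : Type} [CommRing R]

/-- The groups `Ext^i(Q, N)` vanish for all `i < d`. -/
def ExtVanish (Q : ModuleCat R) (N : Type) [AddCommGroup N] [Module R N] (d : ℕ) : Prop :=
  ∀ i < d, Subsingleton (Ext Q (ModuleCat.of R N) i)

variable {Q : ModuleCat R} {L M N : Type} [AddCommGroup L] [Module R L] [AddCommGroup M]
  [Module R M] [AddCommGroup N] [Module R N]

lemma ExtVanish.mono {d e : ℕ} (h : ExtVanish Q N d) (hed : e ≤ d) : ExtVanish Q N e :=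
  fun i hi => h i (hi.trans_le hed)

lemma shortExact_of {f : L →ₗ[R] M} {g : M →ₗ[R] N} (hf : Function.Injective f)
    (hfg : Function.Exact f g) (hg : Function.Surjective g) :
    (ShortComplex.mk (ModuleCat.ofHom f) (ModuleCat.ofHom g)
      (by ext x; exact hfg.apply_apply_eq_zero x)).ShortExact := by
  apply ModuleCat.shortComplex_shortExact
  · exact hfg
  · exact hf
  · exact hg

lemma ExtVanish.right {f : L →ₗ[R] M} {g : M →ₗ[R] N} (hf : Function.Injective f)
    (hfg : Function.Exact f g) (hg : Function.Surjective g) {d : ℕ}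
    (hM : ExtVanish Q M d) (hL : ExtVanish Q L (d + 1)) : ExtVanish Q N d := by
  intro i hi
  have h := hM i hi
  have h' := hL (i + 1) (by omega)
  refine subsingleton_of_forall_eq 0 fun x => ?_
  obtain ⟨y, rfl⟩ := Ext.covariant_sequence_exact₃ Q (shortExact_of hf hfg hg) x rfl
    (h'.elim _ _)
  rw [h.elim y 0, Ext.zero_comp]

lemma ExtVanish.left {f : L →ₗ[R] M} {g : M →ₗ[R] N} (hf : Function.Injective f)
    (hfg : Function.Exact f g) (hg : Function.Surjective g) {d : ℕ}
    (hM : ExtVanish Q M (d + 1)) (hN : ExtVanish Q N d) : ExtVanish Q L (d + 1) := by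
  intro i hi
  have h := hM i hi
  refine subsingleton_of_forall_eq 0 fun x => ?_
  rcases i with _ | i
  · exact Ext.postcomp_mk₀_injective_of_mono Q (ModuleCat.ofHom f)
      (hf := (ModuleCat.mono_iff_injective _).2 hf) (h.elim _ _)
  · obtain ⟨y, rfl⟩ := Ext.covariant_sequence_exact₁ Q (shortExact_of hf hfg hg) x
      (h.elim _ _) rfl
    rw [(hN i (by omega)).elim y 0, Ext.zero_comp]

lemma ExtVanish.retract {f : L →ₗ[R] M} {g : M →ₗ[R] L} (hfg : g ∘ₗ f = LinearMap.id) {d : ℕ}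
    (hM : ExtVanish Q M d) : ExtVanish Q L d := by
  intro i hi
  have h := hM i hi
  refine subsingleton_of_forall_eq 0 fun x => ?_
  have h1 : (x.comp (Ext.mk₀ (ModuleCat.ofHom f)) (add_zero i)).comp
      (Ext.mk₀ (ModuleCat.ofHom g)) (add_zero i) = x := by
    rw [Ext.comp_assoc_of_third_deg_zero, Ext.mk₀_comp_mk₀, ← ModuleCat.ofHom_comp, hfg]
    exact Ext.comp_mk₀_id x
  rw [← h1, h.elim (x.comp (Ext.mk₀ (ModuleCat.ofHom f)) (add_zero i)) 0, Ext.zero_comp]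

lemma ExtVanish.pi {ι : Type} [Fintype ι] {d : ℕ} (hN : ExtVanish Q N d) :
    ExtVanish Q (ι → N) d := by
  classical
  intro i hi
  have h := hN i hi
  refine subsingleton_of_forall_eq 0 fun x => ?_
  have h1 : (𝟙 (ModuleCat.of R (ι → N))) =
      ∑ j, ModuleCat.ofHom (LinearMap.proj j) ≫
        ModuleCat.ofHom (LinearMap.single R (fun _ : ι => N) j) := by
    apply ModuleCat.hom_ext
    rw [ModuleCat.hom_sum]
    refine LinearMap.ext fun v => ?_
    simp only [ModuleCat.hom_id, LinearMap.id_coe, id_eq, ← ModuleCat.ofHom_comp,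
      ModuleCat.hom_ofHom, LinearMap.sum_apply, LinearMap.comp_apply, LinearMap.proj_apply,
      LinearMap.coe_single]
    exact (Finset.univ_sum_single v).symm
  rw [← Ext.comp_mk₀_id x, h1, Ext.mk₀_sum, Ext.comp_sum]
  refine Finset.sum_eq_zero fun j _ => ?_
  rw [← Ext.mk₀_comp_mk₀, ← Ext.comp_assoc_of_third_deg_zero,
    h.elim (x.comp (Ext.mk₀ (ModuleCat.ofHom (LinearMap.proj j))) (add_zero i)) 0, Ext.zero_comp]

lemma ExtVanish.eq_zero {J : Ideal R} (hN : ExtVanish (ModuleCat.of R (R ⧸ J)) N 1) {x : N}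
    (hx : ∀ r ∈ J, r • x = 0) : x = 0 := by
  have h : ModuleCat.ofHom (J.liftQ (LinearMap.toSpanSingleton R N x) fun r hr => by
      simpa using hx r hr) = 0 := (Ext.mk₀_eq_zero_iff _).1 ((hN 0 one_pos).elim _ _)
  have h2 := congrArg (fun f => f.hom (Ideal.Quotient.mk J 1)) h
  simpa [← Ideal.Quotient.mk_eq_mk, -map_one] using h2

lemma extVanish_of_isRegular [IsNoetherianRing R] [Module.Finite R N] {J : Ideal R}
    {rs : List R} (mem : ∀ r ∈ rs, r ∈ J) (reg : RingTheory.Sequence.IsRegular N rs) :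
    ExtVanish (ModuleCat.of R (R ⧸ J)) N rs.length := by
  refine ModuleCat.subsingleton_ext_of_exists_isRegular (Ideal.ofList rs) _ ?_ (ModuleCat.of R N)
    reg.top_ne_smul.symm.lt_top rs (fun r hr => Ideal.subset_span hr) reg
  rw [Module.support_eq_zeroLocus, PrimeSpectrum.zeroLocus_subset_zeroLocus_iff]
  refine le_trans (Ideal.span_le.2 mem) (le_trans (le_of_eq ?_) Ideal.le_radical)
  exact Ideal.annihilator_quotient.symm

lemma ext_smul_eq_zero {J : Ideal R} {r : R} (hr : r ∈ J) {i : ℕ}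
    (x : Ext (ModuleCat.of R (R ⧸ J)) (ModuleCat.of R N) i) : r • x = 0 := by
  have h : r • 𝟙 (ModuleCat.of R (R ⧸ J)) = 0 := by
    apply ModuleCat.hom_ext
    refine LinearMap.ext fun y => ?_
    obtain ⟨y, rfl⟩ := Ideal.Quotient.mk_surjective y
    change r • Ideal.Quotient.mk J y = 0
    rw [← Ideal.Quotient.mk_eq_mk, ← Submodule.Quotient.mk_smul, Submodule.Quotient.mk_eq_zero]
    exact J.mul_mem_right y hr
  have h2 : r • x = (Ext.mk₀ (r • 𝟙 (ModuleCat.of R (R ⧸ J)))).comp x (zero_add i) := by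
    rw [Ext.mk₀_smul, Ext.smul_comp, Ext.mk₀_id_comp]
  rw [h2, h, Ext.mk₀_zero, Ext.zero_comp]

lemma ExtVanish.injective {f : L →ₗ[R] M} {g : M →ₗ[R] N} (hf : Function.Injective f)
    (hfg : Function.Exact f g) (hg : Function.Surjective g) {d : ℕ}
    (hN : ExtVanish Q N d) (x : Ext Q (ModuleCat.of R L) d)
    (hx : x.comp (Ext.mk₀ (ModuleCat.ofHom f)) (add_zero d) = 0) : x = 0 := by
  rcases d with _ | d
  · exact Ext.postcomp_mk₀_injective_of_mono Q (ModuleCat.ofHom f)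
      (hf := (ModuleCat.mono_iff_injective _).2 hf) (by simpa using hx)
  · obtain ⟨y, rfl⟩ := Ext.covariant_sequence_exact₁ Q (shortExact_of hf hfg hg) x hx rfl
    rw [(hN d (by omega)).elim y 0, Ext.zero_comp]

/-- McCoy's theorem: a matrix whose maximal minors annihilate a nonzero module `X` does not act
injectively on columns with entries in `X`. -/
lemma eq_zero_of_minors_smul_eq_zero {X : Type*} [AddCommGroup X] [Module R X] {g t : ℕ}
    (A : Matrix (Fin g) (Fin t) R)
    (hinj : ∀ x : Fin t → X, (∀ i, ∑ j, A i j • x j = 0) → x = 0)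
    (hkill : ∀ (r : Fin t → Fin g) (c : Fin t → Fin t) (x : X),
      (A.submatrix r c).det • x = 0) (x : X) : x = 0 := by
  have key : ∀ s ≤ t, ∀ (r : Fin s → Fin g) (c : Fin s → Fin t) (x : X),
      (A.submatrix r c).det • x = 0 := by
    intro s hs
    induction hs using Nat.decreasingInduction with
    | self => exact hkill
    | of_succ s hs ih =>
      intro r c x
      obtain ⟨q, hq⟩ : ∃ q, q ∉ Set.range c := by
        by_contra! h
        have := Fintype.card_le_of_surjective c h
        simp at this
        omega
      let c' : Fin (s + 1) → Fin t := Fin.cons q c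
      let m : Fin (s + 1) → R := fun a => (-1) ^ (a : ℕ) * (A.submatrix r (c' ∘ a.succAbove)).det
      have h := hinj (∑ a, Pi.single (c' a) (m a • x)) fun i => by
        have h1 := ih (Fin.cons i r) c' x
        rw [Matrix.det_succ_row_zero, Finset.sum_smul] at h1
        rw [← h1]
        simp only [Finset.sum_apply, Finset.smul_sum]
        rw [Finset.sum_comm]
        refine Finset.sum_congr rfl fun a _ => ?_
        rw [Finset.sum_eq_single (c' a)]
        · rw [Pi.single_eq_same, smul_smul]
          congr 1
          simp only [m, Matrix.submatrix_apply, Fin.cons_zero, Matrix.submatrix_submatrix]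
          have : (Fin.cons i r : Fin (s + 1) → Fin g) ∘ Fin.succ = r := by ext; simp
          rw [this]
          ring
        · intro j _ hj
          rw [Pi.single_eq_of_ne hj, smul_zero]
        · simp
      have h2 := congrFun h q
      rw [Finset.sum_apply, Fin.sum_univ_succ, Finset.sum_eq_zero, add_zero] at h2
      · have : (Fin.cons q c : Fin (s + 1) → Fin t) ∘ Fin.succ = c := by ext; simp
        simpa [c', m, this] using h2
      · intro a _
        rw [Pi.single_eq_of_ne]
        intro h3
        exact hq ⟨a, by simpa [c'] using h3.symm⟩
  simpa using key 0 (Nat.zero_le _) Fin.elim0 Fin.elim0 x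

lemma eq_zero_of_matrix_injective {J : Ideal R} {g t : ℕ} (A : Matrix (Fin g) (Fin t) R)
    (hA : ∀ (r : Fin t → Fin g) (c : Fin t → Fin t), (A.submatrix r c).det ∈ J) {d : ℕ}
    (hinj : ∀ x : Ext (ModuleCat.of R (R ⧸ J)) (ModuleCat.of R (Fin t → R)) d,
      x.comp (Ext.mk₀ (ModuleCat.ofHom A.mulVecLin)) (add_zero d) = 0 → x = 0)
    (x : Ext (ModuleCat.of R (R ⧸ J)) (ModuleCat.of R R) d) : x = 0 := by
  refine eq_zero_of_minors_smul_eq_zero A (fun x hx => ?_)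
    (fun r c x => ext_smul_eq_zero (hA r c) x) x
  have h1 : (ModuleCat.ofHom A.mulVecLin) = ∑ j, ∑ i, A i j • (ModuleCat.ofHom (LinearMap.proj j) ≫
      ModuleCat.ofHom (LinearMap.single R (fun _ : Fin g => R) i)) := by
    apply ModuleCat.hom_ext
    simp only [ModuleCat.hom_sum, ModuleCat.hom_smul, ← ModuleCat.ofHom_comp, ModuleCat.hom_ofHom]
    refine LinearMap.ext fun v => funext fun l => ?_
    simp [LinearMap.sum_apply, Matrix.mulVec, dotProduct, Pi.single_apply]
  have hproj (j j' : Fin t) : (ModuleCat.ofHom (LinearMap.single R (fun _ : Fin t => R) j)) ≫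
      ModuleCat.ofHom (LinearMap.proj j') = if j = j' then 𝟙 (ModuleCat.of R R) else 0 := by
    rw [← ModuleCat.ofHom_comp]
    apply ModuleCat.hom_ext
    split_ifs with h
    · subst h
      exact LinearMap.ext_ring (by simp)
    · exact LinearMap.ext_ring (by simp [Ne.symm h])
  have h2 := hinj (∑ j, (x j).comp (Ext.mk₀ (ModuleCat.ofHom
    (LinearMap.single R (fun _ : Fin t => R) j))) (add_zero d)) <| by
      rw [Ext.sum_comp]
      have h3 (j : Fin t) : ((x j).comp (Ext.mk₀ (ModuleCat.ofHom
          (LinearMap.single R (fun _ : Fin t => R) j))) (add_zero d)).comp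
          (Ext.mk₀ (ModuleCat.ofHom A.mulVecLin)) (add_zero d) = ∑ i, (A i j • x j).comp
            (Ext.mk₀ (ModuleCat.ofHom (LinearMap.single R (fun _ : Fin g => R) i)))
              (add_zero d) := by
        rw [Ext.comp_assoc_of_third_deg_zero, Ext.mk₀_comp_mk₀, h1]
        simp only [Preadditive.comp_sum, Linear.comp_smul, ← Category.assoc, hproj]
        rw [Finset.sum_eq_single j _ (by simp)]
        · simp only [if_true, Category.id_comp, Ext.mk₀_sum, Ext.comp_sum, Ext.mk₀_smul,
            Ext.comp_smul, Ext.smul_comp]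
        · intro b _ hb
          simp [hb.symm]
      simp only [h3]
      rw [Finset.sum_comm]
      refine Finset.sum_eq_zero fun i _ => ?_
      rw [← Ext.sum_comp, hx i, Ext.zero_comp]
  funext j
  have h4 := congrArg (fun y => Ext.comp y (Ext.mk₀ (ModuleCat.ofHom (LinearMap.proj j)))
    (add_zero d)) h2
  simp only [Ext.sum_comp, Ext.comp_assoc_of_third_deg_zero, Ext.mk₀_comp_mk₀, hproj,
    Ext.zero_comp] at h4
  rw [Finset.sum_eq_single j _ (by simp)] at h4
  · simpa using h4
  · intro b _ hb
    simp [hb]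

/-- If `I` is resolved by `A : R^t → R^g` and `R ⧸ I` has depth at least `d` in `J ⊇ I_t(A)`,
then `R` has depth at least `d + 2` in `J`. -/
lemma ExtVanish.ring_of_quotient {I J : Ideal R} {g t : ℕ} (A : Matrix (Fin g) (Fin t) R)
    (hA : ∀ (r : Fin t → Fin g) (c : Fin t → Fin t), (A.submatrix r c).det ∈ J)
    {p : (Fin g → R) →ₗ[R] I} (hinj : Function.Injective A.mulVecLin)
    (hex : Function.Exact A.mulVecLin p) (hp : Function.Surjective p) {d : ℕ}
    (hd : ExtVanish (ModuleCat.of R (R ⧸ J)) (R ⧸ I) d) :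
    ExtVanish (ModuleCat.of R (R ⧸ J)) R (d + 2) := by
  have key : ∀ e ≤ d + 2, ExtVanish (ModuleCat.of R (R ⧸ J)) R e := by
    intro e
    induction e with
    | zero => exact fun _ i hi => absurd hi (Nat.not_lt_zero i)
    | succ e ih =>
      intro he i hi
      rcases Nat.lt_succ_iff_lt_or_eq.1 hi with hi | rfl
      · exact ih (by omega) i hi
      · refine subsingleton_of_forall_eq 0 (eq_zero_of_matrix_injective A hA ?_)
        have h0 := ih (by omega)
        have hI : ExtVanish (ModuleCat.of R (R ⧸ J)) I i := by
          rcases i with _ | i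
          · exact fun i hi => absurd hi (Nat.not_lt_zero i)
          · exact ExtVanish.left (f := I.subtype) (g := I.mkQ) (Submodule.subtype_injective I)
              (LinearMap.exact_subtype_mkQ I) (Submodule.mkQ_surjective I) h0
              (hd.mono (by omega))
        exact ExtVanish.injective hinj hex hp hI
  exact key _ le_rfl

end ExtVanish

section Bordered

variable {R : Type} {t : ℕ} (A : Matrix (Fin (t + 1)) (Fin t) R) (x y : Fin (t + 1) → R)
  (v : Fin t → R) (i : Fin (t + 1)) (j : Fin t)

/-- The square matrix `(x | A)`. -/
def colBorder : Matrix (Fin (t + 1)) (Fin (t + 1)) R :=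
  Matrix.of fun i => Fin.cons (x i) (A i)

@[simp] lemma colBorder_zero : colBorder A x i 0 = x i := rfl
@[simp] lemma colBorder_succ : colBorder A x i j.succ = A i j := rfl

end Bordered

section Bordered

variable {R : Type} [CommRing R] {N : Type*} [AddCommGroup N] [Module R N]

lemma sum_adjugate_smul {n : Type*} [Fintype n] [DecidableEq n] (P : Matrix n n R) (s : n → N)
    (i : n) : ∑ j, P.adjugate i j • ∑ k, P j k • s k = P.det • s i := by
  simp only [Finset.smul_sum, smul_smul]
  rw [Finset.sum_comm]
  simp only [← Finset.sum_smul]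
  have h (k : n) : ∑ j, P.adjugate i j * P j k = P.det * (1 : Matrix n n R) i k := by
    rw [← Matrix.mul_apply, Matrix.adjugate_mul, Matrix.smul_apply, smul_eq_mul]
  simp [h, Matrix.one_apply]

lemma sum_adjugate_smul' {n : Type*} [Fintype n] [DecidableEq n] (P : Matrix n n R) (s : n → N)
    (i : n) : ∑ j, P.adjugate j i • ∑ k, P k j • s k = P.det • s i := by
  simpa [← Matrix.adjugate_transpose, Matrix.transpose_apply] using sum_adjugate_smul Pᵀ s i

lemma sum_smul_adjugate {n : Type*} [Fintype n] [DecidableEq n] (P : Matrix n n R) (s : n → N)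
    (i : n) : ∑ j, P i j • ∑ k, P.adjugate j k • s k = P.det • s i := by
  simp only [Finset.smul_sum, smul_smul]
  rw [Finset.sum_comm]
  simp only [← Finset.sum_smul]
  have h (k : n) : ∑ j, P i j * P.adjugate j k = P.det * (1 : Matrix n n R) i k := by
    rw [← Matrix.mul_apply, Matrix.mul_adjugate, Matrix.smul_apply, smul_eq_mul]
  simp [h, Matrix.one_apply]

lemma adjugate_apply_col {n : Type*} [Fintype n] [DecidableEq n] (P : Matrix n n R) (i j : n) :
    P.adjugate i j = (P.updateCol i (Pi.single j 1)).det := by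
  rw [← Matrix.det_transpose, ← Matrix.updateRow_transpose, ← Matrix.adjugate_apply,
    ← Matrix.adjugate_transpose, Matrix.transpose_apply]

lemma sum_univ_succ_succ {t : ℕ} (f : Fin (t + 2) → N) :
    ∑ k, f k = f 0 + f 1 + ∑ k : Fin t, f k.succ.succ := by
  rw [Fin.sum_univ_succ, Fin.sum_univ_succ, ← add_assoc]
  rfl

variable {t : ℕ} (A : Matrix (Fin (t + 1)) (Fin t) R) (x y : Fin (t + 1) → R)
  (v : Fin t → R) (i : Fin (t + 1)) (j : Fin t)

/-- The square matrix with first row `(0, 0, v)` and remaining rows `(x | y | A)`. -/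
def border : Matrix (Fin (t + 2)) (Fin (t + 2)) R :=
  Matrix.of (Fin.cons (Fin.cons 0 (Fin.cons 0 v)) fun i => Fin.cons (x i) (Fin.cons (y i) (A i)))

/-- The determinant of `(x | A)`. -/
def colDet : R := (colBorder A x).det

/-- The determinant of the matrix with first row `(0, 0, v)` and remaining rows `(x | y | A)`. -/
def borderDet : R := (border A x y v).det

@[simp] lemma border_zero_zero : border A x y v 0 0 = 0 := rfl
@[simp] lemma border_zero_one : border A x y v 0 1 = 0 := rfl
@[simp] lemma border_zero_succ : border A x y v 0 j.succ.succ = v j := rfl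
@[simp] lemma border_succ_zero : border A x y v i.succ 0 = x i := rfl
@[simp] lemma border_succ_one : border A x y v i.succ 1 = y i := rfl
@[simp] lemma border_succ_succ : border A x y v i.succ j.succ.succ = A i j := rfl

lemma colBorder_adjugate_zero :
    (colBorder A x).adjugate 0 i = colDet A (Pi.single i 1) := by
  rw [adjugate_apply_col, colDet]
  congr 1
  ext a b
  refine Fin.cases ?_ (fun b => ?_) b <;> simp

lemma border_adjugate_zero :
    (border A x y v).adjugate j.succ.succ 0 = borderDet A x y (Pi.single j 1) := by
  rw [Matrix.adjugate_apply, borderDet]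
  congr 1
  ext a b
  refine Fin.cases ?_ (fun a => ?_) a <;> refine Fin.cases ?_ (fun b => ?_) b <;>
    try refine Fin.cases ?_ (fun b => ?_) b
  all_goals simp [Matrix.updateRow_apply, Pi.single_apply, (Fin.succ_succ_ne_one _).symm]

lemma border_adjugate_succ :
    (border A x y v).adjugate 0 i.succ = borderDet A (Pi.single i 1) y v := by
  rw [adjugate_apply_col, borderDet]
  congr 1
  ext a b
  refine Fin.cases ?_ (fun a => ?_) a <;> refine Fin.cases ?_ (fun b => ?_) b <;>
    try refine Fin.cases ?_ (fun b => ?_) b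
  all_goals simp [Pi.single_apply]

lemma border_adjugate_succ' :
    (border A x y v).adjugate 1 i.succ = borderDet A x (Pi.single i 1) v := by
  rw [adjugate_apply_col, borderDet]
  congr 1
  ext a b
  refine Fin.cases ?_ (fun a => ?_) a <;> refine Fin.cases ?_ (fun b => ?_) b <;>
    try refine Fin.cases ?_ (fun b => ?_) b
  all_goals simp [Pi.single_apply, Fin.succ_succ_ne_one]

lemma borderDet_swap : borderDet A y x v = - borderDet A x y v := by
  rw [borderDet, borderDet]
  have : border A y x v = (border A x y v).submatrix id (Equiv.swap 0 1) := by
    ext a b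
    refine Fin.cases ?_ (fun a => ?_) a <;> refine Fin.cases ?_ (fun b => ?_) b <;>
      try refine Fin.cases ?_ (fun b => ?_) b
    all_goals simp [Equiv.swap_apply_of_ne_of_ne, Fin.ext_iff]
  rw [this, Matrix.det_permute', Equiv.Perm.sign_swap (by simp)]
  simp

lemma colDet_eq_sum : colDet A x = ∑ i, x i * colDet A (Pi.single i 1) := by
  have h := sum_adjugate_smul (colBorder A x) (Pi.single (0 : Fin (t + 1)) (1 : R)) 0
  simpa [Pi.single_apply, colBorder_adjugate_zero, mul_comm, colDet] using h.symm

lemma borderDet_eq_sum : borderDet A x y v = ∑ i, x i * borderDet A (Pi.single i 1) y v := by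
  have h := sum_adjugate_smul (border A x y v) (Pi.single (0 : Fin (t + 2)) (1 : R)) 0
  simpa [Pi.single_apply, Fin.sum_univ_succ (n := t + 1), border_adjugate_succ, mul_comm,
    borderDet] using h.symm

lemma borderDet_eq_sum' : borderDet A x y v = ∑ i, y i * borderDet A x (Pi.single i 1) v := by
  rw [borderDet_swap, borderDet_eq_sum, ← Finset.sum_neg_distrib]
  exact Finset.sum_congr rfl fun i _ => by rw [borderDet_swap]; ring

lemma borderDet_eq_sum_row : borderDet A x y v = ∑ j, v j * borderDet A x y (Pi.single j 1) := by
  have h := sum_adjugate_smul' (border A x y v) (Pi.single (0 : Fin (t + 2)) (1 : R)) 0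
  simpa [Pi.single_apply, Fin.sum_univ_succ, border_adjugate_zero, mul_comm,
    borderDet] using h.symm

lemma colDet_col : colDet A (fun i => A i j) = 0 :=
  Matrix.det_zero_of_column_eq (i := 0) (j := j.succ) (Fin.succ_ne_zero j).symm fun i => by simp

lemma borderDet_row :
    borderDet A x y (A i) = y i * colDet A x - x i * colDet A y := by
  have h1 : borderDet A x y (A i) = ((border A x y (A i)).updateRow 0
      (border A x y (A i) 0 + (-1 : R) • border A x y (A i) i.succ)).det :=
    (Matrix.det_updateRow_add_smul_self _ (Fin.succ_ne_zero i).symm _).symm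
  rw [h1, Matrix.det_succ_row_zero, Fin.sum_univ_succ, Fin.sum_univ_succ]
  have h2 : ((border A x y (A i)).updateRow 0
      (border A x y (A i) 0 + (-1 : R) • border A x y (A i) i.succ)).submatrix Fin.succ
        (Fin.succAbove 0) = colBorder A y := by
    ext a b
    refine Fin.cases ?_ (fun b => ?_) b <;> simp [Matrix.updateRow_apply]
  have h3 : ((border A x y (A i)).updateRow 0
      (border A x y (A i) 0 + (-1 : R) • border A x y (A i) i.succ)).submatrix Fin.succ
        (Fin.succAbove (Fin.succ 0)) = colBorder A x := by
    ext a b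
    refine Fin.cases ?_ (fun b => ?_) b <;> simp [Matrix.updateRow_apply]
  rw [h2, h3, Finset.sum_eq_zero]
  · simp [colDet]
    ring
  · intro k _
    simp

lemma borderDet_col :
    borderDet A (fun i => A i j) y v = - (v j * colDet A y) := by
  set W := border A (fun i => A i j) y v with hW
  have h1 : borderDet A (fun i => A i j) y v = (W.updateCol 0
      (fun k => W k 0 + (-1 : R) • W k j.succ.succ)).det :=
    (Matrix.det_updateCol_add_smul_self _ (Fin.succ_ne_zero _).symm _).symm
  rw [h1, Matrix.det_succ_column_zero, Fin.sum_univ_succ]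
  have h2 : (W.updateCol 0 (fun k => W k 0 + (-1 : R) • W k j.succ.succ)).submatrix
      (Fin.succAbove 0) Fin.succ = colBorder A y := by
    ext a b
    refine Fin.cases ?_ (fun b => ?_) b <;> simp [hW]
  rw [h2, Finset.sum_eq_zero]
  · simp [colDet, hW]
  · intro k _
    simp [hW]

/-- Cramer's rule for the solutions of `A s = 0`. -/
lemma borderDet_smul_of_mulVec_eq_zero {s : Fin t → N} (hs : ∀ i, ∑ j, A i j • s j = 0) :
    borderDet A x y v • s j = borderDet A x y (Pi.single j 1) • ∑ k, v k • s k := by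
  have h := sum_adjugate_smul (border A x y v) (Fin.cons 0 (Fin.cons 0 s)) j.succ.succ
  have h0 (i : Fin (t + 2)) : ∑ k, border A x y v i k •
      (Fin.cons 0 (Fin.cons 0 s) : Fin (t + 2) → N) k =
      (Fin.cons (∑ k, v k • s k) 0 : Fin (t + 2) → N) i := by
    rw [sum_univ_succ_succ]
    refine Fin.cases ?_ (fun i => ?_) i
    · simp
    · simpa using hs i
  simp only [h0] at h
  simpa [Fin.sum_univ_succ (n := t + 1), border_adjugate_zero, borderDet] using h.symm

lemma borderDet_smul_of_vecMul_eq_zero {m : Fin (t + 1) → N} (hm : ∀ j, ∑ i, A i j • m i = 0) :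
    borderDet A x y v • m i = borderDet A (Pi.single i 1) y v • ∑ k, x k • m k +
      borderDet A x (Pi.single i 1) v • ∑ k, y k • m k := by
  have h := (sum_univ_succ_succ _).symm.trans
    (sum_adjugate_smul' (border A x y v) (Fin.cons 0 m) i.succ)
  simpa [Fin.sum_univ_succ (n := t + 1), hm, border_adjugate_succ, border_adjugate_succ',
    borderDet] using h.symm

lemma exists_borderDet_smul_eq (w : Fin (t + 1) → N) : ∃ s : Fin t → N, ∀ i,
    borderDet A x y v • w i = (∑ j, A i j • s j) +
      x i • (∑ k, borderDet A (Pi.single k 1) y v • w k) +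
      y i • ∑ k, borderDet A x (Pi.single k 1) v • w k := by
  refine ⟨fun j => ∑ k : Fin (t + 2), (border A x y v).adjugate j.succ.succ k •
    (Fin.cons 0 w : Fin (t + 2) → N) k, fun i => ?_⟩
  have h := (sum_univ_succ_succ _).symm.trans
    (sum_smul_adjugate (border A x y v) (Fin.cons 0 w) i.succ)
  have h0 : ∑ k, (border A x y v).adjugate 0 k • (Fin.cons 0 w : Fin (t + 2) → N) k =
      ∑ k, borderDet A (Pi.single k 1) y v • w k := by
    rw [Fin.sum_univ_succ]
    simp [border_adjugate_succ]
  have h1 : ∑ k, (border A x y v).adjugate 1 k • (Fin.cons 0 w : Fin (t + 2) → N) k =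
      ∑ k, borderDet A x (Pi.single k 1) v • w k := by
    rw [Fin.sum_univ_succ]
    simp [border_adjugate_succ']
  rw [h0, h1] at h
  simp only [border_succ_zero, border_succ_one, border_succ_succ, Fin.cons_succ] at h
  rw [borderDet, ← h]
  abel

lemma colDet_smul_of_vecMul_eq_zero {m : Fin (t + 1) → N} (hm : ∀ j, ∑ i, A i j • m i = 0) :
    colDet A x • m i = colDet A (Pi.single i 1) • ∑ k, x k • m k := by
  have h := (Fin.sum_univ_succ _).symm.trans (sum_adjugate_smul' (colBorder A x) m i)
  simpa [colBorder_adjugate_zero, hm, colDet] using h.symm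

lemma exists_colDet_smul_eq (w : Fin (t + 1) → N) : ∃ s : Fin t → N, ∀ i,
    colDet A x • w i = (∑ j, A i j • s j) + x i • ∑ k, colDet A (Pi.single k 1) • w k := by
  refine ⟨fun j => ∑ k, (colBorder A x).adjugate j.succ k • w k, fun i => ?_⟩
  have h := (Fin.sum_univ_succ _).symm.trans (sum_smul_adjugate (colBorder A x) w i)
  simp only [colBorder_zero, colBorder_succ, colBorder_adjugate_zero] at h
  rw [colDet, ← h]
  abel

lemma exists_colDet_smul_eq_vecMul (f : Fin t → N) : ∃ m : Fin (t + 1) → N, ∀ j,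
    colDet A x • f j = ∑ i, A i j • m i := by
  refine ⟨fun i => ∑ k, (colBorder A x)ᵀ.adjugate i k • (Fin.cons 0 f : Fin (t + 1) → N) k,
    fun j => ?_⟩
  have h := sum_smul_adjugate (colBorder A x)ᵀ (Fin.cons 0 f) j.succ
  simpa [colDet] using h.symm

lemma colDet_smul_eq_zero {s : Fin t → N} (hs : ∀ i, ∑ j, A i j • s j = 0) :
    colDet A x • s j = 0 := by
  have h := sum_adjugate_smul (colBorder A x) (Fin.cons 0 s) j.succ
  simpa [Fin.sum_univ_succ (n := t), hs, colDet] using h.symm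

end Bordered

section Minors

lemma det_submatrix_bijective {R : Type} [CommRing R] {m n : Type*} [Fintype m] [DecidableEq m]
    [Fintype n] [DecidableEq n] (B : Matrix n n R) {f g : m → n} (hf : f.Bijective)
    (hg : g.Bijective) : ∃ ε : R, (B.submatrix f g).det = ε * B.det := by
  let e := Equiv.ofBijective f hf
  let e' := Equiv.ofBijective g hg
  have h : B.submatrix f g = (B.submatrix id (e.symm.trans e')).submatrix e e := by
    ext i j
    simp [e, e']
  exact ⟨_, by rw [h, Matrix.det_submatrix_equiv_self, Matrix.det_permute']⟩

variable {R : Type} [CommRing R] {t : ℕ} (A : Matrix (Fin (t + 1)) (Fin t) R)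

lemma colDet_single (i : Fin (t + 1)) :
    colDet A (Pi.single i 1) = (-1) ^ (i : ℕ) * (A.submatrix i.succAbove id).det := by
  rw [colDet, Matrix.det_succ_column_zero, Finset.sum_eq_single i]
  · simp only [colBorder_zero, Pi.single_eq_same, mul_one]
    rfl
  · intro b _ hb
    simp [hb]
  · simp

lemma exists_det_submatrix_eq_colDet {r : Fin t → Fin (t + 1)} {c : Fin t → Fin t}
    (hr : r.Injective) (hc : c.Injective) :
    ∃ (ε : R) (x : Fin (t + 1) → R), (A.submatrix r c).det = ε * colDet A x := by
  obtain ⟨i, hi⟩ : ∃ i, ∀ k, r k ≠ i := by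
    by_contra! h
    simpa using Fintype.card_le_of_surjective r h
  obtain ⟨ε, h⟩ := det_submatrix_bijective (colBorder A (Pi.single i 1))
    (f := Fin.cons i r) (g := Fin.cons 0 fun k => (c k).succ)
    ((Fintype.bijective_iff_injective_and_card _).2
      ⟨Fin.cons_injective_iff.2 ⟨fun ⟨k, hk⟩ => hi k hk, hr⟩, rfl⟩)
    ((Fintype.bijective_iff_injective_and_card _).2
      ⟨Fin.cons_injective_iff.2 ⟨fun ⟨k, hk⟩ => Fin.succ_ne_zero _ hk,
        (Fin.succ_injective _).comp hc⟩, rfl⟩)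
  refine ⟨ε, _, Eq.trans ?_ h⟩
  rw [Matrix.det_succ_column_zero, Finset.sum_eq_single 0]
  · simp
    rfl
  · intro b _ hb
    obtain ⟨b, rfl⟩ := Fin.exists_succ_eq.2 hb
    simp [hi b]
  · simp

end Minors

section BorderMinors

variable {R : Type} [CommRing R] {s : ℕ} (A : Matrix (Fin (s + 2)) (Fin (s + 1)) R)

lemma exists_det_submatrix_eq_borderDet {r : Fin s → Fin (s + 2)} {c : Fin s → Fin (s + 1)}
    (hr : r.Injective) (hc : c.Injective) :
    ∃ (ε : R) (x y : Fin (s + 2) → R) (v : Fin (s + 1) → R),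
      (A.submatrix r c).det = ε * borderDet A x y v := by
  obtain ⟨j, hj⟩ : ∃ j, ∀ k, c k ≠ j := by
    by_contra! h
    simpa using Fintype.card_le_of_surjective c h
  obtain ⟨p, hp⟩ : ∃ p, ∀ k, r k ≠ p := by
    by_contra! h
    simpa using Fintype.card_le_of_surjective r h
  have hpr : (Fin.cons p r : Fin (s + 1) → Fin (s + 2)).Injective :=
    Fin.cons_injective_iff.2 ⟨fun ⟨k, hk⟩ => hp k hk, hr⟩
  obtain ⟨q, hq⟩ : ∃ q, ∀ k, (Fin.cons p r : Fin (s + 1) → Fin (s + 2)) k ≠ q := by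
    by_contra! h
    simpa using Fintype.card_le_of_surjective _ h
  have hpq : p ≠ q := hq 0
  have hqr (k) : r k ≠ q := hq k.succ
  let f : Fin 2 ⊕ (Unit ⊕ Fin s) → Fin (s + 3) :=
    Sum.elim ![p.succ, q.succ] (Sum.elim (fun _ => 0) fun k => (r k).succ)
  let g : Fin 2 ⊕ (Unit ⊕ Fin s) → Fin (s + 3) :=
    Sum.elim ![0, 1] (Sum.elim (fun _ => j.succ.succ) fun k => (c k).succ.succ)
  have hcard : Fintype.card (Fin 2 ⊕ (Unit ⊕ Fin s)) = Fintype.card (Fin (s + 3)) := by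
    simp
    omega
  have hf : f.Injective := by
    refine Function.Injective.sumElim ?_ (Function.Injective.sumElim
      (Function.injective_of_subsingleton _) ((Fin.succ_injective _).comp hr)
      fun a b => (Fin.succ_ne_zero _).symm) ?_
    · intro a b
      fin_cases a <;> fin_cases b <;> simp [hpq, hpq.symm]
    · rintro a (b | b)
      · fin_cases a <;> simp
      · fin_cases a
        · simpa using (hp b).symm
        · simpa using (hqr b).symm
  have hg : g.Injective := by
    refine Function.Injective.sumElim ?_ (Function.Injective.sumElim
      (Function.injective_of_subsingleton _)
      (((Fin.succ_injective _).comp (Fin.succ_injective _)).comp hc) fun a b => ?_) ?_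
    · intro a b
      fin_cases a <;> fin_cases b <;> simp
    · simpa using (hj b).symm
    · rintro a (b | b)
      · fin_cases a <;> simp [(Fin.succ_succ_ne_one _).symm, (Fin.succ_ne_zero _).symm]
      · fin_cases a <;> simp [(Fin.succ_succ_ne_one _).symm, (Fin.succ_ne_zero _).symm]
  obtain ⟨ε, h⟩ := det_submatrix_bijective
    (border A (Pi.single p 1) (Pi.single q 1) (Pi.single j 1))
    ((Fintype.bijective_iff_injective_and_card f).2 ⟨hf, hcard⟩)
    ((Fintype.bijective_iff_injective_and_card g).2 ⟨hg, hcard⟩)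
  refine ⟨ε, _, _, _, Eq.trans ?_ h⟩
  have h1 : (border A (Pi.single p 1) (Pi.single q 1) (Pi.single j 1)).submatrix f g =
      fromBlocks 1 (Matrix.of fun i => Sum.elim (fun _ => A (![p, q] i) j)
        (fun k => A (![p, q] i) (c k))) 0
        (fromBlocks 1 0 (Matrix.of fun i _ => A (r i) j) (A.submatrix r c)) := by
    ext (a | a | a) (b | b | b)
    · fin_cases a <;> fin_cases b <;> simp [f, g, hpq, hpq.symm]
    · fin_cases a <;> simp [f, g]
    · fin_cases a <;> simp [f, g]
    · fin_cases b <;> simp [f, g]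
    · simp [f, g]
    · simp [f, g, hj]
    · fin_cases b <;> simp [f, g, hp, hqr]
    · simp [f, g]
    · simp [f, g]
  rw [h1, Matrix.det_fromBlocks_zero₂₁, Matrix.det_fromBlocks_zero₁₂]
  simp

end BorderMinors

section MinorsIdeal

variable {k : Type} [Field k] {n : ℕ}

lemma det_submatrix_mem_minors {g t : ℕ} (A : Matrix (Fin g) (Fin t) (RR k n)) {j : ℕ}
    (r : Fin j → Fin g) (c : Fin j → Fin t) : (A.submatrix r c).det ∈ minors A j := by
  by_cases hr : r.Injective
  · by_cases hc : c.Injective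
    · exact Ideal.subset_span ⟨r, c, hr, hc, rfl⟩
    · obtain ⟨a, b, hab, hne⟩ := Function.not_injective_iff.1 hc
      rw [Matrix.det_zero_of_column_eq hne fun i => by simp [hab]]
      exact zero_mem _
  · obtain ⟨a, b, hab, hne⟩ := Function.not_injective_iff.1 hr
    rw [Matrix.det_zero_of_row_eq hne (funext fun i => by simp [hab])]
    exact zero_mem _

lemma det_submatrix_mem_minors_of_succ {g t : ℕ} (A : Matrix (Fin g) (Fin t) (RR k n)) {j : ℕ}
    (r : Fin (j + 1) → Fin g) (c : Fin (j + 1) → Fin t) :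
    (A.submatrix r c).det ∈ minors A j := by
  rw [Matrix.det_succ_row_zero]
  refine sum_mem fun i _ => Ideal.mul_mem_left _ _ ?_
  rw [Matrix.submatrix_submatrix]
  exact det_submatrix_mem_minors A _ _

lemma minors_le_of_colDet_mem {t : ℕ} (A : Matrix (Fin (t + 1)) (Fin t) (RR k n))
    {K : Ideal (RR k n)} (h : ∀ x, colDet A x ∈ K) : minors A t ≤ K := by
  refine Ideal.span_le.2 ?_
  rintro _ ⟨r, c, hr, hc, rfl⟩
  obtain ⟨ε, x, hx⟩ := exists_det_submatrix_eq_colDet A hr hc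
  rw [hx]
  exact K.mul_mem_left _ (h x)

lemma colDet_mem_minors {t : ℕ} (A : Matrix (Fin (t + 1)) (Fin t) (RR k n))
    (x : Fin (t + 1) → RR k n) : colDet A x ∈ minors A t := by
  rw [colDet_eq_sum]
  refine sum_mem fun i _ => Ideal.mul_mem_left _ _ ?_
  rw [colDet_single]
  exact Ideal.mul_mem_left _ _ (det_submatrix_mem_minors A _ _)

lemma minors_le_of_borderDet_mem {s : ℕ} (A : Matrix (Fin (s + 2)) (Fin (s + 1)) (RR k n))
    {K : Ideal (RR k n)} (h : ∀ x y v, borderDet A x y v ∈ K) : minors A s ≤ K := by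
  refine Ideal.span_le.2 ?_
  rintro _ ⟨r, c, hr, hc, rfl⟩
  obtain ⟨ε, x, y, v, hx⟩ := exists_det_submatrix_eq_borderDet A hr hc
  rw [hx]
  exact K.mul_mem_left _ (h x y v)

end MinorsIdeal

section Torsion

variable {R : Type} [CommRing R] {L M N : Type} [AddCommGroup L] [Module R L] [AddCommGroup M]
  [Module R M] [AddCommGroup N] [Module R N]

lemma ExtVanish.of_exact {Q : ModuleCat R} {f : L →ₗ[R] M} {g : M →ₗ[R] N}
    (hf : Function.Injective f) (hfg : Function.Exact f g) {d : ℕ}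
    (hM : ExtVanish Q M d) (hL : ExtVanish Q L (d + 1)) :
    ExtVanish Q (LinearMap.range g) d :=
  ExtVanish.right (g := g.rangeRestrict) hf
    (fun x => by rw [← hfg x, Subtype.ext_iff]; rfl) g.surjective_rangeRestrict hM hL

lemma ExtVanish.quotient {Q : ModuleCat R} (K : Submodule R M) {d : ℕ}
    (hM : ExtVanish Q M d) (hK : ExtVanish Q K (d + 1)) : ExtVanish Q (M ⧸ K) d :=
  ExtVanish.right (f := K.subtype) (g := K.mkQ) K.injective_subtype
    (LinearMap.exact_subtype_mkQ K) K.mkQ_surjective hM hK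

lemma ExtVanish.eq_zero_of_span {s : Set R}
    (hN : ExtVanish (ModuleCat.of R (R ⧸ Ideal.span s)) N 1) {x : N}
    (hx : ∀ r ∈ s, r • x = 0) : x = 0 := by
  refine hN.eq_zero fun r hr => ?_
  have : Ideal.span s ≤ LinearMap.ker (LinearMap.toSpanSingleton R N x) :=
    Ideal.span_le.2 fun r hr => by simpa using hx r hr
  simpa using this hr

lemma ExtVanish.mem_of_span {s : Set R} {K : Submodule R M}
    (hM : ExtVanish (ModuleCat.of R (R ⧸ Ideal.span s)) M 1)
    (hK : ExtVanish (ModuleCat.of R (R ⧸ Ideal.span s)) K 2) {x : M}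
    (hx : ∀ r ∈ s, r • x ∈ K) : x ∈ K := by
  rw [← Submodule.Quotient.mk_eq_zero]
  refine (ExtVanish.quotient K hM hK).eq_zero_of_span fun r hr => ?_
  rw [← Submodule.Quotient.mk_smul, Submodule.Quotient.mk_eq_zero]
  exact hx r hr

lemma ExtVanish.eq_zero_of_pow {J : Ideal R} (hN : ExtVanish (ModuleCat.of R (R ⧸ J)) N 1)
    (e : ℕ) {x : N} (hx : ∀ r ∈ J ^ e, r • x = 0) : x = 0 := by
  induction e generalizing x with
  | zero => simpa using hx 1 (by simp)
  | succ e ih =>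
    refine ih fun r hr => hN.eq_zero fun a ha => ?_
    rw [smul_smul]
    exact hx _ (by rw [pow_succ']; exact Ideal.mul_mem_mul ha hr)

lemma ExtVanish.eq_zero_of_sq [IsNoetherianRing R] {s : Set R}
    (hN : ExtVanish (ModuleCat.of R (R ⧸ Ideal.span s)) N 1) {x : N}
    (hx : ∀ r ∈ s, r ^ 2 • x = 0) : x = 0 := by
  have h : Ideal.span s ≤ Ideal.radical (LinearMap.ker (LinearMap.toSpanSingleton R N x)) :=
    Ideal.span_le.2 fun r hr => ⟨2, by simpa using hx r hr⟩
  obtain ⟨e, he⟩ := Ideal.exists_pow_le_of_le_radical_of_fg h (IsNoetherian.noetherian _)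
  exact hN.eq_zero_of_pow e fun r hr => by simpa using he hr

lemma ExtVanish.mem_of_sq [IsNoetherianRing R] {s : Set R} {K : Submodule R M}
    (hM : ExtVanish (ModuleCat.of R (R ⧸ Ideal.span s)) M 1)
    (hK : ExtVanish (ModuleCat.of R (R ⧸ Ideal.span s)) K 2) {x : M}
    (hx : ∀ r ∈ s, r ^ 2 • x ∈ K) : x ∈ K := by
  rw [← Submodule.Quotient.mk_eq_zero]
  refine (ExtVanish.quotient K hM hK).eq_zero_of_sq fun r hr => ?_
  rw [← Submodule.Quotient.mk_smul, Submodule.Quotient.mk_eq_zero]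
  exact hx r hr

lemma ExtVanish.range {Q : ModuleCat R} {f : L →ₗ[R] M} (hf : Function.Injective f) {d : ℕ}
    (hL : ExtVanish Q L d) : ExtVanish Q (LinearMap.range f) d :=
  ExtVanish.retract (f := (LinearEquiv.ofInjective f hf).symm.toLinearMap)
    (g := (LinearEquiv.ofInjective f hf).toLinearMap) (by ext; simp) hL

end Torsion

section HilbertBurch

variable {R : Type} [CommRing R] {t : ℕ} (A : Matrix (Fin (t + 1)) (Fin t) R)

/-- The ideal of maximal minors of a `(t + 1) × t` matrix. -/
def colDetIdeal : Ideal R := Ideal.span (Set.range (colDet A))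

lemma colDet_mem (x : Fin (t + 1) → R) : colDet A x ∈ colDetIdeal A :=
  Ideal.subset_span ⟨x, rfl⟩

/-- The determinant of `(x | A)` as a linear form in `x`. -/
def colDetMap : (Fin (t + 1) → R) →ₗ[R] R :=
  Fintype.linearCombination R fun i => colDet A (Pi.single i 1)

lemma colDetMap_apply (x : Fin (t + 1) → R) : colDetMap A x = colDet A x := by
  rw [colDet_eq_sum]
  rfl

lemma mem_colDetIdeal {r : R} : r ∈ colDetIdeal A ↔ ∃ x, colDet A x = r := by
  refine ⟨fun hr => ?_, fun ⟨x, hx⟩ => hx ▸ colDet_mem A x⟩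
  have h : colDetIdeal A ≤ LinearMap.range (colDetMap A) := by
    refine Ideal.span_le.2 ?_
    rintro _ ⟨x, rfl⟩
    exact ⟨x, colDetMap_apply A x⟩
  obtain ⟨x, hx⟩ := h hr
  exact ⟨x, by rw [← hx, colDetMap_apply]⟩

/-- The surjection `R^(t+1) → I_t(A)` given by the signed maximal minors. -/
def toColDetIdeal : (Fin (t + 1) → R) →ₗ[R] colDetIdeal A :=
  (colDetMap A).codRestrict _ fun x => by
    rw [colDetMap_apply]
    exact colDet_mem A x

lemma toColDetIdeal_surjective : Function.Surjective (toColDetIdeal A) := by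
  rintro ⟨r, hr⟩
  obtain ⟨x, rfl⟩ := (mem_colDetIdeal A).1 hr
  exact ⟨x, Subtype.ext (colDetMap_apply A x)⟩

/-- The vector of signed maximal minors. -/
def colDetVec : R →ₗ[R] (Fin (t + 1) → R) :=
  LinearMap.toSpanSingleton R _ fun i => colDet A (Pi.single i 1)

variable {A} (hA : ExtVanish (ModuleCat.of R (R ⧸ colDetIdeal A)) R 2)
include hA

lemma mulVecLin_injective : Function.Injective A.mulVecLin := by
  refine (injective_iff_map_eq_zero _).2 fun s hs => funext fun j => ?_
  refine (hA.mono one_le_two).eq_zero_of_span ?_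
  rintro _ ⟨x, rfl⟩
  exact colDet_smul_eq_zero A x j (s := s) fun i => congrFun hs i

lemma exact_mulVecLin_toColDetIdeal : Function.Exact A.mulVecLin (toColDetIdeal A) := by
  intro w
  have hw : toColDetIdeal A w = 0 ↔ colDet A w = 0 := by
    rw [Subtype.ext_iff, ← colDetMap_apply]
    rfl
  rw [hw]
  refine ⟨fun h => ?_, ?_⟩
  · change w ∈ LinearMap.range A.mulVecLin
    refine ExtVanish.mem_of_span (hA.mono one_le_two).pi
      (ExtVanish.range (mulVecLin_injective hA) hA.pi) ?_
    rintro _ ⟨x, rfl⟩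
    obtain ⟨s, hs⟩ := exists_colDet_smul_eq A x w
    refine ⟨s, funext fun i => ?_⟩
    have h' : ∑ k, colDet A (Pi.single k 1) • w k = 0 := by
      rw [← h, colDet_eq_sum]
      simp only [smul_eq_mul, mul_comm]
    have hi := hs i
    rw [h', smul_zero, add_zero] at hi
    exact hi.symm
  · rintro ⟨s, rfl⟩
    have hs : A.mulVecLin s = ∑ j, s j • fun i => A i j := by
      ext i
      simp [Matrix.mulVec, dotProduct, mul_comm]
    rw [← colDetMap_apply, hs, map_sum]
    refine Finset.sum_eq_zero fun j _ => ?_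
    have := colDet_col A j
    rw [← colDetMap_apply] at this
    rw [map_smul, this, smul_zero]

lemma colDetVec_injective : Function.Injective (colDetVec A) := by
  refine (injective_iff_map_eq_zero _).2 fun r hr => ?_
  refine (hA.mono one_le_two).eq_zero_of_span ?_
  rintro _ ⟨x, rfl⟩
  rw [colDet_eq_sum, Finset.sum_smul]
  refine Finset.sum_eq_zero fun i _ => ?_
  have h : r * colDet A (Pi.single i 1) = 0 := congrFun hr i
  rw [smul_eq_mul, mul_assoc, mul_comm _ r, h, mul_zero]

lemma exact_colDetVec_mulVecLin : Function.Exact (colDetVec A) Aᵀ.mulVecLin := by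
  intro m
  refine ⟨fun h => ?_, ?_⟩
  · change m ∈ LinearMap.range (colDetVec A)
    refine ExtVanish.mem_of_span (hA.mono one_le_two).pi
      (ExtVanish.range (colDetVec_injective hA) hA) ?_
    rintro _ ⟨x, rfl⟩
    refine ⟨∑ k, x k • m k, funext fun i => ?_⟩
    have := colDet_smul_of_vecMul_eq_zero A x i (m := m) fun j => congrFun h j
    rw [Pi.smul_apply, this, smul_eq_mul, mul_comm]
    rfl
  · rintro ⟨r, rfl⟩
    refine funext fun j => ?_
    have h := colDet_col A j
    rw [colDet_eq_sum] at h
    change ∑ i, A i j * (r * colDet A (Pi.single i 1)) = 0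
    simp only [mul_left_comm _ r, ← Finset.mul_sum, h, mul_zero]

end HilbertBurch

section SymSquare

lemma update_vec_zero {M : Type*} (a b c : M) : Function.update ![a, b] 0 c = ![c, b] := by
  ext i
  fin_cases i <;> simp

lemma update_vec_one {M : Type*} (a b c : M) : Function.update ![a, b] 1 c = ![a, c] := by
  ext i
  fin_cases i <;> simp

variable {R : Type} [CommRing R] {M S : Type} [AddCommGroup M] [Module R M] [AddCommGroup S]
  [Module R S]

/-- The bilinear map `mul` exhibits `S` as the second symmetric power of `M`. -/
structure IsSymSquare (mul : M →ₗ[R] M →ₗ[R] S) : Prop where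
  comm : ∀ m m', mul m m' = mul m' m
  span_eq_top : Submodule.span R (Set.range fun q : M × M => mul q.1 q.2) = ⊤
  exists_lift : ∀ {N : Type} [AddCommGroup N] [Module R N] (B : M →ₗ[R] M →ₗ[R] N),
    (∀ m m', B m m' = B m' m) → ∃ f : S →ₗ[R] N, ∀ m m', f (mul m m') = B m m'

lemma IsSymSquare.hom_ext {mul : M →ₗ[R] M →ₗ[R] S} (h : IsSymSquare mul) {N : Type}
    [AddCommGroup N] [Module R N] {f g : S →ₗ[R] N}
    (hfg : ∀ m m', f (mul m m') = g (mul m m')) : f = g :=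
  LinearMap.ext_on h.span_eq_top (by rintro _ ⟨q, rfl⟩; exact hfg _ _)

variable (R M) in
/-- The multiplication `M × M → S₂M`. -/
def symMul : M →ₗ[R] M →ₗ[R] SymPow R M 2 :=
  LinearMap.mk₂ R (fun m m' => Submodule.Quotient.mk (PiTensorProduct.tprod R ![m, m']))
    (fun m₁ m₂ m' => by
      have h := (PiTensorProduct.tprod R (s := fun _ : Fin 2 => M)).map_update_add
        ![m₁, m'] 0 m₁ m₂
      rw [update_vec_zero, update_vec_zero, update_vec_zero] at h
      rw [h, Submodule.Quotient.mk_add])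
    (fun c m m' => by
      have h := (PiTensorProduct.tprod R (s := fun _ : Fin 2 => M)).map_update_smul ![m, m'] 0 c m
      rw [update_vec_zero, update_vec_zero] at h
      rw [h, Submodule.Quotient.mk_smul])
    (fun m m₁ m₂ => by
      have h := (PiTensorProduct.tprod R (s := fun _ : Fin 2 => M)).map_update_add
        ![m, m₁] 1 m₁ m₂
      rw [update_vec_one, update_vec_one, update_vec_one] at h
      rw [h, Submodule.Quotient.mk_add])
    (fun c m m' => by
      have h := (PiTensorProduct.tprod R (s := fun _ : Fin 2 => M)).map_update_smul ![m, m'] 1 c m'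
      rw [update_vec_one, update_vec_one] at h
      rw [h, Submodule.Quotient.mk_smul])

lemma isSymSquare_symMul : IsSymSquare (symMul R M) where
  comm m m' := by
    refine (Submodule.Quotient.eq _).2 (Submodule.subset_span ⟨Equiv.swap 0 1, ![m, m'], ?_⟩)
    congr 2
    ext i
    fin_cases i <;> simp
  span_eq_top := by
    refine Submodule.eq_top_iff'.2 fun s => ?_
    obtain ⟨z, rfl⟩ := Submodule.Quotient.mk_surjective _ s
    induction z using PiTensorProduct.induction_on with
    | smul_tprod r f =>
      rw [Submodule.Quotient.mk_smul]
      refine Submodule.smul_mem _ _ (Submodule.subset_span ⟨(f 0, f 1), ?_⟩)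
      have : f = ![f 0, f 1] := by
        ext i
        fin_cases i <;> rfl
      conv_rhs => rw [this]
      rfl
    | add x y hx hy =>
      rw [Submodule.Quotient.mk_add]
      exact add_mem hx hy
  exists_lift {N} _ _ B hB := by
    let F : MultilinearMap R (fun _ : Fin 2 => M) N := MultilinearMap.mk' (fun f => B (f 0) (f 1))
      (fun f i x y => by fin_cases i <;> simp) (fun f i c x => by fin_cases i <;> simp)
    refine ⟨Submodule.liftQ _ (PiTensorProduct.lift F) (Submodule.span_le.2 ?_), fun m m' => ?_⟩
    · rintro _ ⟨σ, f, rfl⟩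
      rw [SetLike.mem_coe, LinearMap.mem_ker, map_sub, sub_eq_zero, PiTensorProduct.lift.tprod,
        PiTensorProduct.lift.tprod]
      change B (f 0) (f 1) = B (f (σ 0)) (f (σ 1))
      have h01 : σ 0 ≠ σ 1 := fun h => zero_ne_one (σ.injective h)
      generalize σ 0 = a at *
      generalize σ 1 = b at *
      fin_cases a <;> fin_cases b <;> simp_all
    · change PiTensorProduct.lift F (PiTensorProduct.tprod R ![m, m']) = _
      rw [PiTensorProduct.lift.tprod]
      rfl

end SymSquare

section Lift

variable {R : Type} [CommRing R] {P M N : Type} [AddCommGroup P] [Module R P] [AddCommGroup M]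
  [Module R M] [AddCommGroup N] [Module R N]

lemma exists_lift_of_surjective {p : P →ₗ[R] M} (hp : Function.Surjective p) (f : P →ₗ[R] N)
    (hf : ∀ a, p a = 0 → f a = 0) : ∃ g : M →ₗ[R] N, ∀ a, g (p a) = f a := by
  refine ⟨(LinearMap.ker p).liftQ f (fun a ha => hf a ha) ∘ₗ
    (p.quotKerEquivOfSurjective hp).symm.toLinearMap, fun a => ?_⟩
  have : (p.quotKerEquivOfSurjective hp).symm (p a) = Submodule.Quotient.mk a := by
    rw [LinearEquiv.symm_apply_eq]
    rfl
  rw [LinearMap.comp_apply, LinearEquiv.coe_coe, this]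
  rfl

lemma exists_lift₂_of_surjective {p : P →ₗ[R] M} (hp : Function.Surjective p)
    (B : P →ₗ[R] P →ₗ[R] N) (hB : ∀ a b, p a = 0 → B a b = 0)
    (hB' : ∀ a b, p b = 0 → B a b = 0) :
    ∃ g : M →ₗ[R] M →ₗ[R] N, ∀ a b, g (p a) (p b) = B a b := by
  obtain ⟨g, hg⟩ := exists_lift_of_surjective hp B fun a ha => LinearMap.ext fun b => hB a b ha
  obtain ⟨h, hh⟩ := exists_lift_of_surjective hp g.flip fun b hb => LinearMap.ext fun m => by
    obtain ⟨a, rfl⟩ := hp m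
    simpa [hg] using hB' a b hb
  exact ⟨h.flip, fun a b => by simp [hh, hg]⟩

end Lift

section Depth

variable {R : Type} [CommRing R] {t : ℕ} {A : Matrix (Fin (t + 1)) (Fin t) R} {M : Type}
  [AddCommGroup M] [Module R M] {p : (Fin t → R) →ₗ[R] M} {Q : ModuleCat R}

lemma extVanish_coker (hA : ExtVanish (ModuleCat.of R (R ⧸ colDetIdeal A)) R 2)
    (hp : Function.Surjective p) (hex : Function.Exact Aᵀ.mulVecLin p) {d : ℕ}
    (hR : ExtVanish Q R (d + 2)) : ExtVanish Q M d := by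
  have h := ExtVanish.of_exact (colDetVec_injective hA) (exact_colDetVec_mulVecLin hA)
    (hR.mono (by omega : d + 1 ≤ d + 2)).pi hR
  refine ExtVanish.right (Submodule.injective_subtype _) (fun x => ?_) hp
    (hR.mono (by omega : d ≤ d + 2)).pi h
  rw [hex x]
  simp

/-- Symmetric matrices. -/
def symMat (R : Type) [CommRing R] (t : ℕ) : Submodule R (Matrix (Fin t) (Fin t) R) where
  carrier := {X | Xᵀ = X}
  add_mem' := fun {X Y} (hX : Xᵀ = X) (hY : Yᵀ = Y) =>
    show (X + Y)ᵀ = X + Y by rw [Matrix.transpose_add, hX, hY]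
  zero_mem' := Matrix.transpose_zero
  smul_mem' := fun c X (hX : Xᵀ = X) =>
    show (c • X)ᵀ = c • X by rw [Matrix.transpose_smul, hX]

/-- Skew-symmetric matrices. -/
def skewMat (R : Type) [CommRing R] (t : ℕ) : Submodule R (Matrix (Fin t) (Fin t) R) where
  carrier := {X | Xᵀ = -X}
  add_mem' := fun {X Y} (hX : Xᵀ = -X) (hY : Yᵀ = -Y) =>
    show (X + Y)ᵀ = -(X + Y) by rw [Matrix.transpose_add, hX, hY, neg_add]
  zero_mem' := show (0 : Matrix (Fin t) (Fin t) R)ᵀ = -0 by simp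
  smul_mem' := fun c X (hX : Xᵀ = -X) =>
    show (c • X)ᵀ = -(c • X) by rw [Matrix.transpose_smul, hX, smul_neg]

lemma extVanish_matrix {g : ℕ} {d : ℕ} (hR : ExtVanish Q R d) :
    ExtVanish Q (Matrix (Fin g) (Fin t) R) d :=
  (hR.pi (ι := Fin t)).pi (ι := Fin g)

variable [Invertible (2 : R)]

/-- The symmetric part of a matrix. -/
def symPart (R : Type) [CommRing R] [Invertible (2 : R)] (t : ℕ) :
    Matrix (Fin t) (Fin t) R →ₗ[R] symMat R t where
  toFun X := ⟨(⅟2 : R) • (X + Xᵀ), by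
    change _ᵀ = _
    rw [Matrix.transpose_smul, Matrix.transpose_add, Matrix.transpose_transpose, add_comm]⟩
  map_add' X Y := Subtype.ext (by simp [← smul_add]; abel_nf)
  map_smul' c X := Subtype.ext (by simp [← smul_add, smul_comm c])

/-- The skew-symmetric part of a matrix. -/
def skewPart (R : Type) [CommRing R] [Invertible (2 : R)] (t : ℕ) :
    Matrix (Fin t) (Fin t) R →ₗ[R] skewMat R t where
  toFun X := ⟨(⅟2 : R) • (X - Xᵀ), by
    change _ᵀ = _
    rw [Matrix.transpose_smul, Matrix.transpose_sub, Matrix.transpose_transpose, ← smul_neg,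
      neg_sub]⟩
  map_add' X Y := Subtype.ext (by simp [← smul_add]; abel_nf)
  map_smul' c X := Subtype.ext (by simp [← smul_sub, smul_comm c])

lemma invOf_two_smul_add_self {N : Type*} [AddCommGroup N] [Module R N] (x : N) :
    (⅟2 : R) • (x + x) = x := by
  rw [← two_smul R x, smul_smul, invOf_mul_self, one_smul]

lemma symPart_comp_subtype : symPart R t ∘ₗ (symMat R t).subtype = LinearMap.id := by
  refine LinearMap.ext fun X => Subtype.ext ?_
  change (⅟2 : R) • ((X : Matrix (Fin t) (Fin t) R) + (X : Matrix (Fin t) (Fin t) R)ᵀ) =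
    (X : Matrix (Fin t) (Fin t) R)
  rw [show (X : Matrix (Fin t) (Fin t) R)ᵀ = X from X.2, invOf_two_smul_add_self]

lemma skewPart_comp_subtype : skewPart R t ∘ₗ (skewMat R t).subtype = LinearMap.id := by
  refine LinearMap.ext fun X => Subtype.ext ?_
  change (⅟2 : R) • ((X : Matrix (Fin t) (Fin t) R) - (X : Matrix (Fin t) (Fin t) R)ᵀ) =
    (X : Matrix (Fin t) (Fin t) R)
  rw [show (X : Matrix (Fin t) (Fin t) R)ᵀ = -X from X.2, sub_neg_eq_add,
    invOf_two_smul_add_self]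

lemma eq_zero_of_eq_neg {r : R} (h : r = -r) : r = 0 := by
  have := invOf_two_smul_add_self (R := R) r
  rwa [show r + r = 0 by nth_rw 1 [h]; ring, smul_zero, eq_comm] at this

variable (A) in
/-- The map `Y ↦ Y A` on skew-symmetric matrices. -/
def skewMul : skewMat R (t + 1) →ₗ[R] Matrix (Fin (t + 1)) (Fin t) R where
  toFun Y := (Y : Matrix (Fin (t + 1)) (Fin (t + 1)) R) * A
  map_add' X Y := by simp [Matrix.add_mul]
  map_smul' c Y := by simp

variable (A) in
/-- The map sending `Z` to the symmetric part of `Aᵀ Z`. -/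
def symMulTranspose : Matrix (Fin (t + 1)) (Fin t) R →ₗ[R] symMat R t where
  toFun Z := symPart R t (Aᵀ * Z)
  map_add' X Y := by simp [Matrix.mul_add]
  map_smul' c Y := by simp

lemma symMulTranspose_eq_zero_iff {Z : Matrix (Fin (t + 1)) (Fin t) R} :
    symMulTranspose A Z = 0 ↔ (Aᵀ * Z)ᵀ = -(Aᵀ * Z) := by
  rw [eq_neg_iff_add_eq_zero, Subtype.ext_iff]
  change (⅟2 : R) • (Aᵀ * Z + (Aᵀ * Z)ᵀ) = 0 ↔ _
  rw [add_comm]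
  refine ⟨fun h => ?_, fun h => by rw [h, smul_zero]⟩
  simpa using congrArg (fun X => (2 : R) • X) h

section
variable [IsNoetherianRing R] (hA : ExtVanish (ModuleCat.of R (R ⧸ colDetIdeal A)) R 2)
include hA

lemma skewMul_injective : Function.Injective (skewMul A) := by
  refine (injective_iff_map_eq_zero _).2 fun ⟨Y, hY⟩ hYA => Subtype.ext ?_
  replace hYA : Y * A = 0 := hYA
  replace hY : Yᵀ = -Y := hY
  refine (extVanish_matrix (hA.mono one_le_two)).eq_zero_of_sq ?_
  rintro _ ⟨x, rfl⟩
  have hW : (colBorder A x)ᵀ * Y * colBorder A x = 0 := by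
    have hskew : ((colBorder A x)ᵀ * Y * colBorder A x)ᵀ =
        -((colBorder A x)ᵀ * Y * colBorder A x) := by
      simp [Matrix.transpose_mul, hY, Matrix.mul_assoc]
    have hsucc (i : Fin (t + 1)) (j : Fin t) :
        ((colBorder A x)ᵀ * Y * colBorder A x) i j.succ = 0 := by
      change ((colBorder A x)ᵀ * Y * A) i j = 0
      rw [Matrix.mul_assoc, hYA, Matrix.mul_zero]
      rfl
    ext i j
    have hij := congrFun (congrFun hskew i) j
    rw [Matrix.transpose_apply, Matrix.neg_apply] at hij
    refine Fin.cases (fun hij => ?_) (fun j _ => hsucc i j) j hij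
    refine Fin.cases (fun hij => ?_) (fun i hij => ?_) i hij
    · exact eq_zero_of_eq_neg hij
    · rw [hsucc, zero_eq_neg] at hij
      exact hij
  calc colDet A x ^ 2 • Y
      = ((colBorder A x)ᵀ.adjugate * (colBorder A x)ᵀ) * Y *
          (colBorder A x * (colBorder A x).adjugate) := by
        rw [Matrix.adjugate_mul, Matrix.mul_adjugate, Matrix.det_transpose]
        simp [colDet, smul_smul, pow_two]
    _ = (colBorder A x)ᵀ.adjugate * ((colBorder A x)ᵀ * Y * colBorder A x) *
          (colBorder A x).adjugate := by simp only [Matrix.mul_assoc]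
    _ = 0 := by rw [hW, Matrix.mul_zero, Matrix.zero_mul]

lemma exact_skewMul_symMulTranspose : Function.Exact (skewMul A) (symMulTranspose A) := by
  intro Z
  rw [symMulTranspose_eq_zero_iff]
  refine ⟨fun h => ?_, ?_⟩
  · change Z ∈ LinearMap.range (skewMul A)
    refine ExtVanish.mem_of_sq (extVanish_matrix (hA.mono one_le_two))
      (ExtVanish.range (skewMul_injective hA)
        (ExtVanish.retract skewPart_comp_subtype (extVanish_matrix hA))) ?_
    rintro _ ⟨x, rfl⟩
    let V := colBorder A x
    let P : Matrix (Fin (t + 1)) (Fin (t + 1)) R := Matrix.of fun i =>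
      Fin.cons ((Fin.cons 0 fun k => -(Vᵀ * Z) 0 k : Fin (t + 1) → R) i) ((Vᵀ * Z) i)
    have hP : Pᵀ = -P := by
      ext i j
      refine Fin.cases ?_ (fun i => ?_) i <;> refine Fin.cases ?_ (fun j => ?_) j
      · simp [P]
      · simp [P]
      · simp [P]
      · exact congrFun (congrFun h i) j
    have hY : (V.adjugateᵀ * P * V.adjugate)ᵀ = -(V.adjugateᵀ * P * V.adjugate) := by
      simp [Matrix.transpose_mul, hP, Matrix.mul_assoc]
    refine ⟨⟨_, hY⟩, ?_⟩
    change V.adjugateᵀ * P * V.adjugate * A = colDet A x ^ 2 • Z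
    ext i j
    calc (V.adjugateᵀ * P * V.adjugate * A) i j
        = (V.adjugateᵀ * P * V.adjugate * V) i j.succ := rfl
      _ = V.det * (V.adjugateᵀ * P) i j.succ := by
        rw [Matrix.mul_assoc _ _ V, Matrix.adjugate_mul]
        simp
      _ = V.det * (V.adjugateᵀ * (Vᵀ * Z)) i j := rfl
      _ = _ := by
        rw [← Matrix.mul_assoc, ← Matrix.transpose_mul, Matrix.mul_adjugate]
        simp [V, colDet, pow_two, mul_assoc]
  · rintro ⟨⟨Y, hY⟩, rfl⟩
    replace hY : Yᵀ = -Y := hY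
    change (Aᵀ * (Y * A))ᵀ = - (Aᵀ * (Y * A))
    simp [Matrix.transpose_mul, hY, Matrix.mul_assoc]

end

end Depth

section SymDepth

variable {R : Type} [CommRing R] {t : ℕ} {A : Matrix (Fin (t + 1)) (Fin t) R} {M S : Type}
  [AddCommGroup M] [Module R M] [AddCommGroup S] [Module R S] {p : (Fin t → R) →ₗ[R] M}
  {mul : M →ₗ[R] M →ₗ[R] S} {Q : ModuleCat R}

lemma map_eq_sum_single (p : (Fin t → R) →ₗ[R] M) (v : Fin t → R) :
    p v = ∑ i, v i • p (Pi.single i 1) := by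
  conv_lhs => rw [pi_eq_sum_univ' v]
  simp only [map_sum, map_smul]

variable (p mul) in
/-- The map sending a matrix `X` to `∑ Xᵢⱼ eᵢ eⱼ`. -/
def symEval : Matrix (Fin t) (Fin t) R →ₗ[R] S where
  toFun X := ∑ i, ∑ j, X i j • mul (p (Pi.single i 1)) (p (Pi.single j 1))
  map_add' X Y := by simp [add_smul, Finset.sum_add_distrib]
  map_smul' c X := by simp [Finset.smul_sum, smul_smul]

lemma symEval_vecMulVec (v w : Fin t → R) :
    symEval p mul (vecMulVec v w) = mul (p v) (p w) := by
  rw [map_eq_sum_single p v, map_eq_sum_single p w]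
  simp only [map_sum, map_smul, LinearMap.sum_apply, LinearMap.smul_apply, Finset.smul_sum,
    smul_smul]
  refine Eq.trans ?_ Finset.sum_comm
  change ∑ i, ∑ j, (v i * w j) • _ = _
  simp only [mul_comm]

lemma symEval_transpose (hS : IsSymSquare mul) (X : Matrix (Fin t) (Fin t) R) :
    symEval p mul Xᵀ = symEval p mul X := by
  change ∑ i, ∑ j, X j i • _ = ∑ i, ∑ j, X i j • _
  rw [Finset.sum_comm]
  exact Finset.sum_congr rfl fun i _ => Finset.sum_congr rfl fun j _ => by rw [hS.comm]

lemma apply_row_eq_zero (hex : Function.Exact Aᵀ.mulVecLin p) (i : Fin (t + 1)) :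
    p (A i) = 0 := by
  refine (hex _).2 ⟨Pi.single i 1, ?_⟩
  ext j
  simp

lemma transpose_mul_eq_sum (Z : Matrix (Fin (t + 1)) (Fin t) R) :
    Aᵀ * Z = ∑ i, vecMulVec (A i) (Z i) := by
  ext a b
  simp [Matrix.mul_apply, Matrix.sum_apply, vecMulVec_apply]

lemma symEval_transpose_mul (hex : Function.Exact Aᵀ.mulVecLin p)
    (Z : Matrix (Fin (t + 1)) (Fin t) R) : symEval p mul (Aᵀ * Z) = 0 := by
  rw [transpose_mul_eq_sum, map_sum]
  refine Finset.sum_eq_zero fun i _ => ?_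
  rw [symEval_vecMulVec, apply_row_eq_zero hex, map_zero, LinearMap.zero_apply]

lemma symEval_surjective (hS : IsSymSquare mul) (hp : Function.Surjective p) :
    Function.Surjective (symEval p mul) := by
  rw [← LinearMap.range_eq_top, eq_top_iff, ← hS.span_eq_top, Submodule.span_le]
  rintro _ ⟨⟨m, m'⟩, rfl⟩
  obtain ⟨v, rfl⟩ := hp m
  obtain ⟨w, rfl⟩ := hp m'
  exact ⟨_, symEval_vecMulVec v w⟩

variable [Invertible (2 : R)]

lemma symEval_symPart (hS : IsSymSquare mul) (X : Matrix (Fin t) (Fin t) R) :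
    symEval p mul (symPart R t X : Matrix (Fin t) (Fin t) R) = symEval p mul X := by
  change symEval p mul ((⅟2 : R) • (X + Xᵀ)) = _
  rw [map_smul, map_add, symEval_transpose hS, invOf_two_smul_add_self]

lemma symPart_transpose (X : Matrix (Fin t) (Fin t) R) : symPart R t Xᵀ = symPart R t X :=
  Subtype.ext (congrArg (fun Y => (⅟2 : R) • Y) (by
    rw [Matrix.transpose_transpose, add_comm]))

lemma exact_symMulTranspose_symEval (hS : IsSymSquare mul) (hp : Function.Surjective p)
    (hex : Function.Exact Aᵀ.mulVecLin p) :
    Function.Exact (symMulTranspose A) (symEval p mul ∘ₗ (symMat R t).subtype) := by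
  intro X
  refine ⟨fun h => ?_, ?_⟩
  · let K := LinearMap.range (symMulTranspose A)
    let B : (Fin t → R) →ₗ[R] (Fin t → R) →ₗ[R] (symMat R t ⧸ K) :=
      LinearMap.mk₂ R (fun v w => K.mkQ (symPart R t (vecMulVec v w)))
        (fun v v' w => by rw [add_vecMulVec, map_add, map_add])
        (fun c v w => by rw [smul_vecMulVec, map_smul, map_smul])
        (fun v w w' => by rw [vecMulVec_add, map_add, map_add])
        (fun c v w => by rw [vecMulVec_smul, map_smul, map_smul])
    have hcomm (v w) : B v w = B w v := by
      change K.mkQ (symPart R t (vecMulVec v w)) = K.mkQ (symPart R t (vecMulVec w v))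
      rw [← symPart_transpose, transpose_vecMulVec]
    have hB (v w) (hv : p v = 0) : B v w = 0 := by
      obtain ⟨z, rfl⟩ := (hex v).1 hv
      refine (Submodule.Quotient.mk_eq_zero _).2 ⟨vecMulVec z w, ?_⟩
      change symPart R t (Aᵀ * vecMulVec z w) = symPart R t (vecMulVec (Aᵀ *ᵥ z) w)
      rw [mul_vecMulVec]
    obtain ⟨B', hB'⟩ := exists_lift₂_of_surjective hp B hB
      fun v w hw => by rw [hcomm, hB w v hw]
    obtain ⟨f, hf⟩ := hS.exists_lift B' fun m m' => by
      obtain ⟨v, rfl⟩ := hp m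
      obtain ⟨w, rfl⟩ := hp m'
      rw [hB', hB', hcomm]
    have key (Y : Matrix (Fin t) (Fin t) R) :
        f (symEval p mul Y) = K.mkQ (symPart R t Y) := by
      have hY : Y = ∑ i, vecMulVec (Pi.single i 1) (Y i) := by
        ext a b
        simp [Matrix.sum_apply, vecMulVec_apply, Pi.single_apply]
      conv_lhs => rw [hY]
      conv_rhs => rw [hY]
      simp only [map_sum]
      refine Finset.sum_congr rfl fun i _ => ?_
      rw [symEval_vecMulVec, hf, hB']
      rfl
    have h1 := key X
    rw [show symEval p mul X = 0 from h, map_zero,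
      show symPart R t X = X from LinearMap.congr_fun symPart_comp_subtype X] at h1
    exact (Submodule.Quotient.mk_eq_zero _).1 h1.symm
  · rintro ⟨Z, rfl⟩
    exact (symEval_symPart hS _).trans (symEval_transpose_mul hex Z)

lemma extVanish_range_symMulTranspose [IsNoetherianRing R]
    (hA : ExtVanish (ModuleCat.of R (R ⧸ colDetIdeal A)) R 2) {d : ℕ}
    (hR : ExtVanish Q R (d + 2)) :
    ExtVanish Q (LinearMap.range (symMulTranspose A)) (d + 1) :=
  ExtVanish.of_exact (skewMul_injective hA) (exact_skewMul_symMulTranspose hA)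
    (extVanish_matrix (hR.mono (by omega : d + 1 ≤ d + 2)))
    (ExtVanish.retract skewPart_comp_subtype (extVanish_matrix hR))

lemma extVanish_symMat {d : ℕ} (hR : ExtVanish Q R d) : ExtVanish Q (symMat R t) d :=
  ExtVanish.retract symPart_comp_subtype (extVanish_matrix hR)

lemma extVanish_symSquare [IsNoetherianRing R]
    (hA : ExtVanish (ModuleCat.of R (R ⧸ colDetIdeal A)) R 2)
    (hS : IsSymSquare mul) (hp : Function.Surjective p)
    (hex : Function.Exact Aᵀ.mulVecLin p) {d : ℕ} (hR : ExtVanish Q R (d + 2)) :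
    ExtVanish Q S d := by
  have h4 : Function.Exact (LinearMap.range (symMulTranspose A)).subtype
      (symEval p mul ∘ₗ (symMat R t).subtype) := fun x => by
    rw [exact_symMulTranspose_symEval hS hp hex x, Submodule.coe_subtype, Subtype.range_coe]
    rfl
  have h5 : Function.Surjective (symEval p mul ∘ₗ (symMat R t).subtype) := fun s => by
    obtain ⟨X, rfl⟩ := symEval_surjective hS hp s
    exact ⟨symPart R t X, symEval_symPart hS X⟩
  exact ExtVanish.right (LinearMap.range (symMulTranspose A)).injective_subtype h4 h5
    (extVanish_symMat (hR.mono (by omega : d ≤ d + 2))) (extVanish_range_symMulTranspose hA hR)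

end SymDepth

section MatAct

variable {R : Type} [CommRing R] {N : Type} [AddCommGroup N] [Module R N] {g t : ℕ}

variable (N) in
/-- The action of a matrix over `R` on column vectors with entries in an `R`-module. -/
def matAct (A : Matrix (Fin g) (Fin t) R) : (Fin t → N) →ₗ[R] (Fin g → N) :=
  LinearMap.pi fun i => ∑ j, A i j • LinearMap.proj j

lemma matAct_apply (A : Matrix (Fin g) (Fin t) R) (s : Fin t → N) (i : Fin g) :
    matAct N A s i = ∑ j, A i j • s j := by
  simp [matAct]

end MatAct

section Complex

variable {R : Type} [CommRing R] {t : ℕ} {A : Matrix (Fin (t + 1)) (Fin t) R} {M S : Type}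
  [AddCommGroup M] [Module R M] [AddCommGroup S] [Module R S] {p : (Fin t → R) →ₗ[R] M}
  {mul : M →ₗ[R] M →ₗ[R] S}

variable (A) in
/-- The ideal of submaximal minors of a `(t + 1) × t` matrix. -/
def borderDetIdeal : Ideal R :=
  Ideal.span (Set.range fun q : (Fin (t + 1) → R) × (Fin (t + 1) → R) × (Fin t → R) =>
    borderDet A q.1 q.2.1 q.2.2)

variable (A) in
/-- The bordered determinant as a linear form in the bordering row. -/
def borderDetMap (x y : Fin (t + 1) → R) : (Fin t → R) →ₗ[R] R :=
  Fintype.linearCombination R fun j => borderDet A x y (Pi.single j 1)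

lemma borderDetMap_apply (x y : Fin (t + 1) → R) (v : Fin t → R) :
    borderDetMap A x y v = borderDet A x y v := by
  rw [borderDet_eq_sum_row]
  rfl

lemma colDet_smul_coker (hp : Function.Surjective p) (hex : Function.Exact Aᵀ.mulVecLin p)
    (x : Fin (t + 1) → R) (m : M) : colDet A x • m = 0 := by
  obtain ⟨f, rfl⟩ := hp m
  obtain ⟨z, hz⟩ := exists_colDet_smul_eq_vecMul A x f
  rw [← map_smul]
  refine (hex _).2 ⟨z, funext fun j => ?_⟩
  rw [Pi.smul_apply, hz j]
  rfl

lemma borderDet_smul_comm (hex : Function.Exact Aᵀ.mulVecLin p) (x y : Fin (t + 1) → R)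
    (f g : Fin t → R) : borderDet A x y f • p g = borderDet A x y g • p f := by
  have hrel (i) : ∑ j, A i j • p (Pi.single j 1) = 0 := by
    rw [← map_eq_sum_single, apply_row_eq_zero hex]
  rw [map_eq_sum_single p g, borderDet_eq_sum_row A x y g, Finset.smul_sum, Finset.sum_smul]
  refine Finset.sum_congr rfl fun j _ => ?_
  rw [smul_comm, borderDet_smul_of_mulVec_eq_zero A x y f j hrel, ← map_eq_sum_single, smul_smul]

lemma exists_borderDet_pairing (hS : IsSymSquare mul) (hp : Function.Surjective p)
    (hex : Function.Exact Aᵀ.mulVecLin p) (x y : Fin (t + 1) → R) :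
    ∃ μ : S →ₗ[R] M, ∀ f m, μ (mul (p f) m) = borderDet A x y f • m := by
  obtain ⟨γ, hγ⟩ := exists_lift_of_surjective hp (LinearMap.lsmul R M ∘ₗ borderDetMap A x y)
    fun f hf => by
      obtain ⟨z, rfl⟩ := (hex f).1 hf
      have hz : Aᵀ.mulVecLin z = ∑ i, z i • A i := by
        ext j
        simp [Matrix.vecMul, dotProduct, mul_comm]
      refine LinearMap.ext fun m => ?_
      rw [LinearMap.comp_apply, LinearMap.lsmul_apply, hz, map_sum, Finset.sum_smul]
      refine Finset.sum_eq_zero fun i _ => ?_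
      rw [map_smul, borderDetMap_apply, borderDet_row, smul_assoc, sub_smul, mul_smul, mul_smul,
        colDet_smul_coker hp hex, colDet_smul_coker hp hex, smul_zero, smul_zero, sub_zero,
        smul_zero]
  have hγ' (f m) : γ (p f) m = borderDet A x y f • m := by
    rw [hγ, LinearMap.comp_apply, LinearMap.lsmul_apply, borderDetMap_apply]
  obtain ⟨μ, hμ⟩ := hS.exists_lift γ fun m m' => by
    obtain ⟨f, rfl⟩ := hp m
    obtain ⟨g, rfl⟩ := hp m'
    rw [hγ', hγ', borderDet_smul_comm hex]
  exact ⟨μ, fun f m => by rw [hμ, hγ']⟩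

variable (p mul) in
/-- The map `m ↦ (eⱼ m)ⱼ`. -/
def mulBasis : M →ₗ[R] (Fin t → S) :=
  LinearMap.pi fun j => mul (p (Pi.single j 1))

lemma sum_smul_mulBasis (v : Fin t → R) (m : M) :
    ∑ j, v j • mulBasis p mul m j = mul (p v) m := by
  rw [map_eq_sum_single p v]
  simp [mulBasis, LinearMap.sum_apply]

/-- The map built from the pairings attached to pairs of rows. -/
def pairingMap (μ : (Fin (t + 1) → R) → (Fin (t + 1) → R) → S →ₗ[R] M) :
    (Fin (t + 1) → S) →ₗ[R] (Fin (t + 1) → M) :=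
  LinearMap.pi fun l => ∑ i, μ (Pi.single i 1) (Pi.single l 1) ∘ₗ LinearMap.proj i

variable {μ : (Fin (t + 1) → R) → (Fin (t + 1) → R) → S →ₗ[R] M}

lemma pairingMap_apply (w : Fin (t + 1) → S) (l : Fin (t + 1)) :
    pairingMap μ w l = ∑ i, μ (Pi.single i 1) (Pi.single l 1) (w i) := by
  simp [pairingMap]

variable (hS : IsSymSquare mul) (hp : Function.Surjective p)
  (hex : Function.Exact Aᵀ.mulVecLin p)
  (hμ : ∀ x y f m, μ x y (mul (p f) m) = borderDet A x y f • m)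

include hS hp in
lemma IsSymSquare.hom_ext' {N : Type} [AddCommGroup N] [Module R N] {f g : S →ₗ[R] N}
    (h : ∀ v m, f (mul (p v) m) = g (mul (p v) m)) : f = g :=
  hS.hom_ext fun m m' => by
    obtain ⟨v, rfl⟩ := hp m
    exact h v m'

include hS hp hμ

lemma pairing_eq_sum_left (x y : Fin (t + 1) → R) (σ : S) :
    μ x y σ = ∑ i, x i • μ (Pi.single i 1) y σ := by
  have : μ x y = ∑ i, x i • μ (Pi.single i 1) y := hS.hom_ext' hp fun f m => by
    simp only [LinearMap.sum_apply, LinearMap.smul_apply, hμ]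
    rw [borderDet_eq_sum, Finset.sum_smul]
    exact Finset.sum_congr rfl fun i _ => mul_smul _ _ _
  rw [this]
  simp

lemma pairing_eq_sum_right (x y : Fin (t + 1) → R) (σ : S) :
    μ x y σ = ∑ i, y i • μ x (Pi.single i 1) σ := by
  have : μ x y = ∑ i, y i • μ x (Pi.single i 1) := hS.hom_ext' hp fun f m => by
    simp only [LinearMap.sum_apply, LinearMap.smul_apply, hμ]
    rw [borderDet_eq_sum', Finset.sum_smul]
    exact Finset.sum_congr rfl fun i _ => mul_smul _ _ _
  rw [this]
  simp

lemma sum_smul_pairingMap (w : Fin (t + 1) → S) (y : Fin (t + 1) → R) :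
    ∑ l, y l • pairingMap μ w l = ∑ i, μ (Pi.single i 1) y (w i) := by
  simp only [pairingMap_apply, Finset.smul_sum]
  rw [Finset.sum_comm]
  exact Finset.sum_congr rfl fun i _ => (pairing_eq_sum_right hS hp hμ _ _ _).symm

include hex

lemma pairing_col_left (j : Fin t) (y : Fin (t + 1) → R) (σ : S) :
    μ (fun i => A i j) y σ = 0 := by
  have : μ (fun i => A i j) y = 0 := hS.hom_ext' hp fun f m => by
    rw [hμ, borderDet_col, neg_smul, mul_smul, colDet_smul_coker hp hex, smul_zero, neg_zero,
      LinearMap.zero_apply]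
  rw [this, LinearMap.zero_apply]

lemma pairing_col_right (x : Fin (t + 1) → R) (j : Fin t) (σ : S) :
    μ x (fun i => A i j) σ = 0 := by
  have : μ x (fun i => A i j) = 0 := hS.hom_ext' hp fun f m => by
    rw [hμ, borderDet_swap, borderDet_col, neg_neg, mul_smul, colDet_smul_coker hp hex, smul_zero,
      LinearMap.zero_apply]
  rw [this, LinearMap.zero_apply]

lemma mul_pairing (x y : Fin (t + 1) → R) (f : Fin t → R) (σ : S) :
    mul (p f) (μ x y σ) = borderDet A x y f • σ := by
  have : mul (p f) ∘ₗ μ x y = borderDet A x y f • LinearMap.id := hS.hom_ext' hp fun g m => by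
    simp only [LinearMap.comp_apply, hμ, LinearMap.smul_apply, LinearMap.id_apply, map_smul]
    rw [← LinearMap.smul_apply, ← map_smul, borderDet_smul_comm hex, map_smul,
      LinearMap.smul_apply]
  exact LinearMap.congr_fun this σ

omit hS hp hex in
lemma mulBasis_injective
    (hM : ExtVanish (ModuleCat.of R (R ⧸ borderDetIdeal A)) M 1) :
    Function.Injective (mulBasis p mul) := by
  refine (injective_iff_map_eq_zero _).2 fun m hm => hM.eq_zero_of_span ?_
  rintro _ ⟨⟨x, y, v⟩, rfl⟩
  change borderDet A x y v • m = 0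
  rw [← hμ, ← sum_smul_mulBasis, hm]
  simp

lemma exact_mulBasis_matAct (hM : ExtVanish (ModuleCat.of R (R ⧸ borderDetIdeal A)) M 2)
    (hS1 : ExtVanish (ModuleCat.of R (R ⧸ borderDetIdeal A)) S 1) :
    Function.Exact (mulBasis p mul) (matAct S A) := by
  intro s
  refine ⟨fun hs => ?_, ?_⟩
  · change s ∈ LinearMap.range (mulBasis p mul)
    refine ExtVanish.mem_of_span hS1.pi
      (ExtVanish.range (mulBasis_injective hμ (hM.mono one_le_two)) hM) ?_
    rintro _ ⟨⟨x, y, v⟩, rfl⟩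
    refine ⟨μ x y (∑ k, v k • s k), funext fun j => ?_⟩
    change mul (p (Pi.single j 1)) _ = borderDet A x y v • s j
    rw [mul_pairing hS hp hex hμ, borderDet_smul_of_mulVec_eq_zero A x y v j fun i => ?_]
    rw [← matAct_apply, hs, Pi.zero_apply]
  · rintro ⟨m, rfl⟩
    ext i
    rw [matAct_apply, sum_smul_mulBasis, apply_row_eq_zero hex, map_zero, LinearMap.zero_apply,
      Pi.zero_apply]

lemma exact_matAct_pairingMap (hM : ExtVanish (ModuleCat.of R (R ⧸ borderDetIdeal A)) M 3)
    (hS2 : ExtVanish (ModuleCat.of R (R ⧸ borderDetIdeal A)) S 2) :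
    Function.Exact (matAct S A) (pairingMap μ) := by
  intro w
  refine ⟨fun hw => ?_, ?_⟩
  · change w ∈ LinearMap.range (matAct S A)
    refine ExtVanish.mem_of_span (hS2.mono one_le_two).pi
      (ExtVanish.of_exact (mulBasis_injective hμ (hM.mono (by omega)))
        (exact_mulBasis_matAct hS hp hex hμ (hM.mono (by omega)) (hS2.mono one_le_two))
        hS2.pi hM) ?_
    rintro _ ⟨⟨x, y, v⟩, rfl⟩
    have h (y : Fin (t + 1) → R) : ∑ k, borderDet A (Pi.single k 1) y v • w k = 0 := by
      simp only [← mul_pairing hS hp hex hμ, ← map_sum]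
      rw [← sum_smul_pairingMap hS hp hμ, hw]
      simp
    obtain ⟨s, hs⟩ := exists_borderDet_smul_eq A x y v w
    refine ⟨s, funext fun i => ?_⟩
    have h' : ∑ k, borderDet A x (Pi.single k 1) v • w k = 0 := by
      rw [← neg_zero, ← h x, ← Finset.sum_neg_distrib]
      exact Finset.sum_congr rfl fun k _ => by rw [borderDet_swap, neg_smul]
    rw [matAct_apply]
    change _ = borderDet A x y v • w i
    rw [hs i, h y, h', smul_zero, smul_zero, add_zero, add_zero]
  · rintro ⟨s, rfl⟩
    ext l
    rw [pairingMap_apply]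
    simp only [matAct_apply, map_sum, map_smul]
    rw [Finset.sum_comm]
    refine Finset.sum_eq_zero fun j _ => ?_
    rw [← pairing_eq_sum_left hS hp hμ (fun i => A i j), pairing_col_left hS hp hex hμ]

lemma exact_pairingMap_matAct (hM : ExtVanish (ModuleCat.of R (R ⧸ borderDetIdeal A)) M 4)
    (hS3 : ExtVanish (ModuleCat.of R (R ⧸ borderDetIdeal A)) S 3) :
    Function.Exact (pairingMap μ) (matAct M Aᵀ) := by
  intro m
  refine ⟨fun hm => ?_, ?_⟩
  · change m ∈ LinearMap.range (pairingMap μ)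
    have h1 : ExtVanish (ModuleCat.of R (R ⧸ borderDetIdeal A))
        (LinearMap.range (matAct S A)) 3 :=
      ExtVanish.of_exact (mulBasis_injective hμ (hM.mono (by omega)))
        (exact_mulBasis_matAct hS hp hex hμ (hM.mono (by omega)) (hS3.mono (by omega)))
        hS3.pi hM
    have h2 : Function.Exact (LinearMap.range (matAct S A)).subtype (pairingMap μ) := fun w => by
      rw [exact_matAct_pairingMap hS hp hex hμ (hM.mono (by omega)) (hS3.mono (by omega)) w,
        Submodule.coe_subtype, Subtype.range_coe]
      rfl
    refine ExtVanish.mem_of_span (hM.mono (by omega)).pi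
      (ExtVanish.of_exact (Submodule.injective_subtype _) h2 (hS3.mono (by omega)).pi h1) ?_
    rintro _ ⟨⟨x, y, v⟩, rfl⟩
    refine ⟨fun l => x l • mul (p v) (∑ k, y k • m k) - y l • mul (p v) (∑ k, x k • m k),
      funext fun l => ?_⟩
    rw [pairingMap_apply]
    simp only [map_sub, map_smul, Finset.sum_sub_distrib]
    rw [← pairing_eq_sum_left hS hp hμ, ← pairing_eq_sum_left hS hp hμ, hμ, hμ]
    change _ = borderDet A x y v • m l
    rw [borderDet_smul_of_vecMul_eq_zero A x y v l fun j => ?_, borderDet_swap A (Pi.single l 1) y,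
      neg_smul, sub_neg_eq_add, add_comm]
    have := congrFun hm j
    rwa [matAct_apply] at this
  · rintro ⟨w, rfl⟩
    ext j
    rw [matAct_apply]
    change ∑ l, A l j • pairingMap μ w l = 0
    rw [sum_smul_pairingMap hS hp hμ w fun l => A l j]
    exact Finset.sum_eq_zero fun i _ => pairing_col_right hS hp hex hμ _ _ _

end Complex

section Complex

variable {R : Type} [CommRing R] {t : ℕ} {A : Matrix (Fin (t + 1)) (Fin t) R} {M S : Type}
  [AddCommGroup M] [Module R M] [AddCommGroup S] [Module R S] {p : (Fin t → R) →ₗ[R] M}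
  {mul : M →ₗ[R] M →ₗ[R] S}

lemma nonempty_quotient_range_matAct_equiv (hS : IsSymSquare mul) (hp : Function.Surjective p)
    (hex : Function.Exact Aᵀ.mulVecLin p)
    (hM : ExtVanish (ModuleCat.of R (R ⧸ borderDetIdeal A)) M 4)
    (hS3 : ExtVanish (ModuleCat.of R (R ⧸ borderDetIdeal A)) S 3) :
    Nonempty (((Fin (t + 1) → S) ⧸ LinearMap.range (matAct S A)) ≃ₗ[R]
      LinearMap.ker (matAct M Aᵀ)) := by
  choose μ hμ using fun x y => exists_borderDet_pairing hS hp hex x y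
  have h1 := exact_matAct_pairingMap hS hp hex hμ (hM.mono (by omega)) (hS3.mono (by omega))
  have h2 := exact_pairingMap_matAct hS hp hex hμ hM hS3
  exact ⟨(Submodule.quotEquivOfEq _ _ h1.linearMap_ker_eq.symm).trans
    ((pairingMap μ).quotKerEquivRange.trans (LinearEquiv.ofEq _ _ h2.linearMap_ker_eq.symm))⟩

end Complex

section TensorMatAct

variable {R : Type} [CommRing R] {N : Type} [AddCommGroup N] [Module R N] {g t : ℕ}

lemma matAct_comp_piScalarRight (A : Matrix (Fin g) (Fin t) R) :
    matAct N A ∘ₗ (TensorProduct.piScalarRight R R N (Fin t)).toLinearMap =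
      (TensorProduct.piScalarRight R R N (Fin g)).toLinearMap ∘ₗ A.mulVecLin.lTensor N := by
  refine TensorProduct.ext' fun x v => funext fun i => ?_
  rw [LinearMap.comp_apply, matAct_apply]
  simp [Matrix.mulVec, dotProduct, Finset.sum_smul, smul_smul]

lemma nonempty_ker_lTensor_equiv (A : Matrix (Fin g) (Fin t) R) :
    Nonempty (LinearMap.ker (A.mulVecLin.lTensor N) ≃ₗ[R] LinearMap.ker (matAct N A)) := by
  refine ⟨LinearEquiv.ofSubmodules (TensorProduct.piScalarRight R R N (Fin t)) _ _ ?_⟩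
  have h := LinearEquiv.ker_comp (TensorProduct.piScalarRight R R N (Fin g))
    (A.mulVecLin.lTensor N)
  rw [← matAct_comp_piScalarRight, LinearMap.ker_comp] at h
  rw [← h]
  exact Submodule.map_comap_eq_of_surjective (LinearEquiv.surjective _) _

lemma nonempty_quotient_range_matAct_equiv_tensor {I : Type} [AddCommGroup I] [Module R I]
    {A : Matrix (Fin g) (Fin t) R} {f : (Fin g → R) →ₗ[R] I}
    (hf : Function.Exact A.mulVecLin f) (hf' : Function.Surjective f) :
    Nonempty (((Fin g → N) ⧸ LinearMap.range (matAct N A)) ≃ₗ[R] N ⊗[R] I) := by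
  refine ⟨(Submodule.Quotient.equiv _ _ (TensorProduct.piScalarRight R R N (Fin g))
    ?_).symm.trans (lTensor.equiv N hf hf')⟩
  rw [← LinearMap.range_comp, ← LinearMap.range_comp_of_range_eq_top (matAct N A)
    (LinearEquiv.range (TensorProduct.piScalarRight R R N (Fin t))), matAct_comp_piScalarRight]

end TensorMatAct

section Resolution

open Limits

variable {C : Type*} [Category* C] [Abelian C] [EnoughProjectives C] {X₀ X₁ Z : C} (d : X₁ ⟶ X₀)

/-- The projective cover of the kernel of a morphism, as a continuation of a complex. -/
def syzygyStep {X Y : C} (f : X ⟶ Y) : Σ' (W : C) (g : W ⟶ X), g ≫ f = 0 :=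
  ⟨Projective.syzygies f, Projective.d f,
    (Category.assoc _ _ _).trans
      ((congrArg (Projective.π (kernel f) ≫ ·) (kernel.condition f)).trans comp_zero)⟩

/-- A complex of projective objects extending a given morphism on the left. -/
def resolutionComplex : ChainComplex C ℕ :=
  ChainComplex.mk' X₀ X₁ d syzygyStep

lemma resolutionComplex_d_one_zero : (resolutionComplex d).d 1 0 = d :=
  ChainComplex.mk'_d_1_0 _ _ _ _

/-- The higher terms of `resolutionComplex`. -/
def resolutionComplexXIso (n : ℕ) : (resolutionComplex d).X (n + 2) ≅
    (syzygyStep ((resolutionComplex d).d (n + 1) n)).1 :=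
  ChainComplex.mk'XIso X₀ X₁ d syzygyStep n

lemma resolutionComplex_d (n : ℕ) : (resolutionComplex d).d (n + 2) (n + 1) =
    (resolutionComplexXIso d n).hom ≫ (syzygyStep ((resolutionComplex d).d (n + 1) n)).2.1 :=
  ChainComplex.mk'_d X₀ X₁ d syzygyStep n

lemma resolutionComplex_exactAt_succ (n : ℕ) : (resolutionComplex d).ExactAt (n + 1) := by
  rw [HomologicalComplex.exactAt_iff' _ (n + 1 + 1) (n + 1) n (by simp) (by simp)]
  let S := ShortComplex.mk _ _ (syzygyStep ((resolutionComplex d).d (n + 1) n)).2.2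
  let e : (resolutionComplex d).sc' (n + 1 + 1) (n + 1) n ≅ S :=
    ShortComplex.isoMk (resolutionComplexXIso d n) (Iso.refl _) (Iso.refl _)
      ((resolutionComplex_d d n).symm.trans (Category.comp_id _).symm)
      ((Category.id_comp _).trans (Category.comp_id _).symm)
  exact (ShortComplex.exact_iff_of_iso e).2 (exact_d_f ((resolutionComplex d).d (n + 1) n))

lemma projective_resolutionComplex_X [Projective X₀] [Projective X₁] :
    ∀ n, Projective ((resolutionComplex d).X n)
  | 0 => ‹Projective X₀›
  | 1 => ‹Projective X₁›
  | n + 2 => Projective.of_iso (resolutionComplexXIso d n).symm (Projective.projective_over _)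

variable {d} {π : X₀ ⟶ Z} (w : d ≫ π = 0)

/-- The projective resolution of `Z` extending a projective presentation `X₁ ⟶ X₀ ⟶ Z`. -/
def resolutionOfPresentation [Projective X₀] [Projective X₁] [Epi π]
    (h : (ShortComplex.mk d π w).Exact) : ProjectiveResolution Z where
  complex := resolutionComplex d
  projective := projective_resolutionComplex_X d
  π := (ChainComplex.toSingle₀Equiv _ _).symm ⟨π, by
    rw [resolutionComplex_d_one_zero]
    exact w⟩
  quasiIso := ⟨fun n => by
    cases n
    · rw [ChainComplex.quasiIsoAt₀_iff, ShortComplex.quasiIso_iff_of_zeros']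
      · refine (ShortComplex.exact_and_epi_g_iff_of_iso ?_).2 ⟨h, ‹Epi π›⟩
        refine ShortComplex.isoMk (Iso.refl _) (Iso.refl _) (Iso.refl _) ?_ ?_
        · refine (Category.id_comp _).trans (Eq.trans ?_ (Category.comp_id _).symm)
          exact (resolutionComplex_d_one_zero d).symm
        · refine (Category.id_comp _).trans (Eq.trans ?_ (Category.comp_id _).symm)
          exact (ChainComplex.toSingle₀Equiv_symm_apply_f_zero (C := resolutionComplex d) π _).symm
      all_goals rfl
    · rw [quasiIsoAt_iff_exactAt']
      · apply resolutionComplex_exactAt_succ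
      · apply ChainComplex.exactAt_succ_single_obj⟩

end Resolution

section TorOne

open Limits MonoidalCategory

variable {R : Type} [CommRing R] {M N F₀ F₁ : Type} [AddCommGroup M] [Module R M]
  [AddCommGroup N] [Module R N] [AddCommGroup F₀] [Module R F₀] [AddCommGroup F₁] [Module R F₁]

/-- `Tor₁(N, M)` is the kernel of `N ⊗ F₁ → N ⊗ F₀` for a free presentation `F₁ → F₀ → M`
whose syzygies are annihilated by tensoring with `N`. -/
lemma nonempty_torM_one_iso_ker_lTensor [Module.Free R F₀] [Module.Free R F₁]
    {f : F₁ →ₗ[R] F₀} {p : F₀ →ₗ[R] M} (hex : Function.Exact f p) (hp : Function.Surjective p)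
    (hker : ∀ z, f z = 0 → ∀ y : N, y ⊗ₜ[R] z = 0) :
    Nonempty (TorM R 1 N M ≅ ModuleCat.of R (LinearMap.ker (f.lTensor N))) := by
  have : Projective (ModuleCat.of R F₀) :=
    (IsProjective.iff_projective (R := R) F₀).1 inferInstance
  have : Projective (ModuleCat.of R F₁) :=
    (IsProjective.iff_projective (R := R) F₁).1 inferInstance
  have : Epi (ModuleCat.ofHom p) := (ModuleCat.epi_iff_surjective _).2 hp
  have w : ModuleCat.ofHom f ≫ ModuleCat.ofHom p = 0 :=
    ModuleCat.hom_ext hex.linearMap_comp_eq_zero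
  let P := resolutionOfPresentation w
    ((ShortComplex.ShortExact.moduleCat_exact_iff_function_exact _).2 hex)
  let T := (tensoringLeft (ModuleCat R)).obj (ModuleCat.of R N)
  let K := (T.mapHomologicalComplex _).obj P.complex
  have hd : P.complex.d 1 0 = ModuleCat.ofHom f := resolutionComplex_d_one_zero _
  have hzero : (K.sc' 2 1 0).f = 0 := by
    refine ModuleCat.hom_ext (TensorProduct.ext' fun y z => hker _ ?_ y)
    have h := P.complex.d_comp_d 2 1 0
    rw [hd] at h
    exact LinearMap.congr_fun (congrArg ModuleCat.Hom.hom h) z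
  have hg : (K.sc' 2 1 0).g = ModuleCat.ofHom (f.lTensor N) :=
    congrArg (ModuleCat.of R N ◁ ·) hd
  refine ⟨P.isoLeftDerivedObj T 1 ≪≫ K.homologyIsoSc' 2 1 0 (by simp) (by simp) ≪≫
    (ShortComplex.LeftHomologyData.ofIsLimitKernelFork _ hzero _
      (kernelIsKernel _)).homologyIso ≪≫ ModuleCat.kernelIsoKer _ ≪≫
    (LinearEquiv.ofEq _ _ ?_).toModuleIso⟩
  rw [hg]
  rfl

end TorOne

section Presentation

variable {R : Type} [CommRing R] {M N : Type} [AddCommGroup M] [Module R M]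
  [AddCommGroup N] [Module R N] {t : ℕ}
  {A : Matrix (Fin (t + 1)) (Fin t) R} {p : (Fin t → R) →ₗ[R] M}

lemma tmul_eq_zero_of_transpose_mulVec_eq_zero
    (hA : ExtVanish (ModuleCat.of R (R ⧸ colDetIdeal A)) R 2)
    (hN : ∀ x (y : N), colDet A x • y = 0) {z : Fin (t + 1) → R} (hz : Aᵀ.mulVecLin z = 0)
    (y : N) : y ⊗ₜ[R] z = 0 := by
  obtain ⟨r, rfl⟩ := (exact_colDetVec_mulVecLin hA z).1 hz
  rw [← (TensorProduct.piScalarRight R R N (Fin (t + 1))).map_eq_zero_iff]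
  funext i
  simp [colDetVec, hN]

lemma nonempty_torM_one_iso_ker_matAct
    (hA : ExtVanish (ModuleCat.of R (R ⧸ colDetIdeal A)) R 2)
    (hp : Function.Surjective p) (hex : Function.Exact Aᵀ.mulVecLin p) :
    Nonempty (TorM R 1 M M ≅ ModuleCat.of R (LinearMap.ker (matAct M Aᵀ))) := by
  obtain ⟨e⟩ := nonempty_torM_one_iso_ker_lTensor (N := M) hex hp fun _ hz =>
    tmul_eq_zero_of_transpose_mulVec_eq_zero hA (colDet_smul_coker hp hex) hz
  obtain ⟨e'⟩ := nonempty_ker_lTensor_equiv (N := M) Aᵀ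
  exact ⟨e ≪≫ e'.toModuleIso⟩

/-- For a module presented by the transpose of a `(t + 1) × t` matrix with sufficiently general
maximal and submaximal minors, `Tor₁(M, M)` is the tensor product of the symmetric square of `M`
with the ideal of maximal minors. -/
theorem nonempty_torM_one_iso_symSquare_tensor [IsNoetherianRing R] [Invertible (2 : R)] {s : ℕ}
    {A : Matrix (Fin (s + 2)) (Fin (s + 1)) R} {p : (Fin (s + 1) → R) →ₗ[R] M}
    {S : Type} [AddCommGroup S] [Module R S] {mul : M →ₗ[R] M →ₗ[R] S} (hS : IsSymSquare mul)
    (hA : ExtVanish (ModuleCat.of R (R ⧸ colDetIdeal A)) R 2)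
    (hB : ExtVanish (ModuleCat.of R (R ⧸ borderDetIdeal A)) R 6)
    (hp : Function.Surjective p) (hex : Function.Exact Aᵀ.mulVecLin p) :
    Nonempty (TorM R 1 M M ≅ ModuleCat.of R (S ⊗[R] colDetIdeal A)) := by
  obtain ⟨e₁⟩ := nonempty_torM_one_iso_ker_matAct hA hp hex
  obtain ⟨e₂⟩ := nonempty_quotient_range_matAct_equiv hS hp hex (extVanish_coker hA hp hex hB)
    ((extVanish_symSquare hA hS hp hex hB).mono (by norm_num))
  obtain ⟨e₃⟩ := nonempty_quotient_range_matAct_equiv_tensor (N := S)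
    (exact_mulVecLin_toColDetIdeal hA) (toColDetIdeal_surjective A)
  exact ⟨e₁ ≪≫ (e₂.symm.trans e₃).toModuleIso⟩

end Presentation

variable {k : Type} [Field k] {n : ℕ}

lemma minors_eq_colDetIdeal {t : ℕ} (A : Matrix (Fin (t + 1)) (Fin t) (RR k n)) :
    minors A t = colDetIdeal A := by
  refine le_antisymm (minors_le_of_colDet_mem A (colDet_mem A)) fun z hz => ?_
  obtain ⟨x, rfl⟩ := (mem_colDetIdeal A).1 hz
  exact colDet_mem_minors A x

/-- Lemma `lem3`(i); c = 2.
If `B_t = R/I_t(φ)` is standard determinantal of codimension `2`, `J = I_{t-1}(φ)` and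
`depth_J B_t ≥ 4`, then `Tor₁^R(M, M) ≅ S₂M ⊗_R I_t(φ)`. -/
theorem statement_8 {k : Type} [Field k] [IsAlgClosed k] [CharZero k]
    {n t : ℕ}
    (A : Matrix (Fin (t + 1)) (Fin t) (RR k n))
    (a : Fin (t + 1) → ℤ) (b : Fin t → ℤ)
    (hhom : IsHomogMatrix A a b)
    (hdet : depthEQ (minors A t) (RR k n) 2)
    (hdepth : depthGE (minors A (t - 1)) (RR k n ⧸ minors A t) 4) :
    misoM (TorM (RR k n) 1 (Mdl A) (Mdl A))
      (ModuleCat.of (RR k n)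
        ((SymPow (RR k n) (Mdl A) 2) ⊗[RR k n] ↥(minors A t))) := by
  rw [minors_eq_colDetIdeal] at hdet hdepth ⊢
  obtain ⟨rs, hlen, hmem, hreg⟩ := hdet.1
  have hA : ExtVanish (ModuleCat.of (RR k n) (RR k n ⧸ colDetIdeal A)) (RR k n) 2 :=
    hlen ▸ extVanish_of_isRegular hmem hreg
  obtain ⟨qs, hlen', hmem', hreg'⟩ := hdepth
  cases t with
  | zero =>
    have : Subsingleton (RR k n ⧸ colDetIdeal A) := by
      rw [Ideal.Quotient.subsingleton_iff, ← minors_eq_colDetIdeal, Ideal.eq_top_iff_one]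
      exact Ideal.subset_span ⟨Fin.elim0, Fin.elim0, fun i => i.elim0, fun i => i.elim0, by simp⟩
    exact absurd (Subsingleton.elim _ _) hreg'.top_ne_smul
  | succ s =>
    have hle : minors A s ≤ borderDetIdeal A :=
      minors_le_of_borderDet_mem A fun x y v => Ideal.subset_span ⟨(x, y, v), rfl⟩
    have hQ : ExtVanish (ModuleCat.of (RR k n) (RR k n ⧸ borderDetIdeal A))
        (RR k n ⧸ colDetIdeal A) 4 :=
      hlen' ▸ extVanish_of_isRegular (fun r hr => hle (hmem' r hr)) hreg'
    have hB := ExtVanish.ring_of_quotient A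
      (fun r c => hle (det_submatrix_mem_minors_of_succ A r c)) (mulVecLin_injective hA)
      (exact_mulVecLin_toColDetIdeal hA) (toColDetIdeal_surjective A) hQ
    have : Invertible (2 : RR k n) :=
      (Invertible.map (MvPolynomial.C (σ := Fin (n + 1))) (2 : k)).copy _ (map_ofNat _ 2).symm
    exact nonempty_torM_one_iso_symSquare_tensor isSymSquare_symMul hA hB
      (Submodule.mkQ_surjective _) (LinearMap.exact_map_mkQ_range (phiStar A))

end KMR
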